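/- arXiv:1503.02286 — 4 statements merged into one kernel-verified Lean document; each statement's English description precedes it below -/
import Mathlib

section
/- For every constant η > 0 there is a constant c > 0 such that for all n, k ∈ ℕ with k ≥ (log₂ n)^{2+η}, letting t = ⌈7/η⌉ + 1, there exists a function BExt : ({0,1}^n)^t × ({0,1}^n)^t → {0,1}^m with m = ⌊0.9k⌋ such that: for all independent X = (X₁,…,X_t) and Y = (Y₁,…,Y_t) that are each (k,…,k) block sources with t blocks of n bits, one has |(BExt(X,Y), Y) − (U_m, Y)| ≤ ε and |(BExt(X,Y), X) − (U_m, X)| ≤ ε, where ε = 2^{−k^c}. -/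
open Finset

abbrev BitStr (n : ℕ) := Fin n → Bool

/-- `p` is a probability distribution on the finite type `α`. -/
def IsProb {α : Type*} [Fintype α] (p : α → ℝ) : Prop :=
  (∀ a, 0 ≤ p a) ∧ ∑ a, p a = 1

/-- Statistical distance: `max_{T ⊆ α} |p(T) − q(T)|`. -/
noncomputable def statDist {α : Type*} [Fintype α] (p q : α → ℝ) : ℝ :=
  ⨆ T : Finset α, |∑ a ∈ T, p a - ∑ a ∈ T, q a|

/-- `H_∞(p) ≥ k`, i.e. every point has probability at most `2^(-k)`. -/
def IsKSource {α : Type*} [Fintype α] (p : α → ℝ) (k : ℝ) : Prop :=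
  ∀ a, p a ≤ (2 : ℝ) ^ (-k)

/-- The uniform distribution on a finite type. -/
noncomputable def unif (α : Type*) [Fintype α] : α → ℝ := fun _ => (Fintype.card α : ℝ)⁻¹


/-- Probability that the first `i` blocks of a sample from `p` agree with `x`. -/
noncomputable def prefixProb {n t : ℕ} (p : (Fin t → BitStr n) → ℝ) (i : ℕ)
    (x : Fin t → BitStr n) : ℝ :=
  ∑ x', if ∀ j : Fin t, (j : ℕ) < i → x' j = x j then p x' else 0

/-- `p` is a `(k, …, k)` block source with `t` blocks: each block has conditional
min-entropy at least `k` given any fixing of the previous blocks in the support. -/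
def IsBlockSourceT {n t : ℕ} (p : (Fin t → BitStr n) → ℝ) (k : ℝ) : Prop :=
  ∀ i : Fin t, ∀ x, prefixProb p i x ≠ 0 →
    prefixProb p ((i : ℕ) + 1) x ≤ (2 : ℝ) ^ (-k) * prefixProb p i x


lemma hoeff_unif {β : Type} [Fintype β] [DecidableEq β] [Nonempty β] (A : Finset β) (s : ℝ) :
    ∑ z : β, Real.exp (s * ((if z ∈ A then 1 else 0) - (A.card : ℝ) / Fintype.card β))
      ≤ Fintype.card β * Real.exp (s ^ 2 / 8) := by
  let _ : MeasurableSpace β := ⊤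
  have hM : (0 : ℝ) < Fintype.card β := by exact_mod_cast Fintype.card_pos
  set μ := (PMF.uniformOfFintype β).toMeasure with hμ
  have h := ProbabilityTheory.hasSubgaussianMGF_of_mem_Icc (μ := μ)
    (X := fun z => if z ∈ A then (1 : ℝ) else 0) (a := 0) (b := 1)
    (measurable_of_finite _).aemeasurable
    (Filter.Eventually.of_forall fun z => by
      by_cases hz : z ∈ A <;> simp [hz])
  have h2 := h.mgf_le s
  unfold ProbabilityTheory.mgf at h2
  rw [hμ, PMF.integral_eq_sum, PMF.integral_eq_sum] at h2
  simp only [PMF.uniformOfFintype_apply, ENNReal.toReal_inv, ENNReal.toReal_natCast,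
    smul_eq_mul, ← Finset.mul_sum] at h2
  rw [inv_mul_le_iff₀ hM] at h2
  refine le_trans (le_of_eq ?_) (h2.trans (le_of_eq ?_))
  · refine Finset.sum_congr rfl fun z _ => ?_
    congr 3
    rw [Finset.sum_ite_mem]
    simp [div_eq_inv_mul]
  · congr 2
    norm_num
    ring

/-- centered indicator -/
noncomputable def cind {β : Type} [Fintype β] [DecidableEq β] (A : Finset β) (z : β) : ℝ :=
  (if z ∈ A then 1 else 0) - (A.card : ℝ) / Fintype.card β

lemma count_bad {ι β : Type} [Fintype ι] [DecidableEq ι] [Fintype β] [DecidableEq β] [Nonempty β]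
    (A : ι → Finset β) (S : Finset ι) (ε : ℝ) (hε : 0 ≤ ε) :
    (((univ : Finset (ι → β)).filter
      fun f => ε * S.card < ∑ i ∈ S, cind (A i) (f i)).card : ℝ)
      ≤ Fintype.card (ι → β) * Real.exp (- (2 * ε ^ 2 * S.card)) := by
  set B := (univ : Finset (ι → β)).filter
      fun f => ε * S.card < ∑ i ∈ S, cind (A i) (f i) with hB
  have h1 : (B.card : ℝ) * Real.exp (4 * ε * (ε * S.card)) ≤
      ∑ f : ι → β, Real.exp (4 * ε * ∑ i ∈ S, cind (A i) (f i)) := by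
    rw [← nsmul_eq_mul, ← Finset.sum_const]
    refine le_trans (Finset.sum_le_sum (fun f hf => ?_))
      (Finset.sum_le_sum_of_subset_of_nonneg (Finset.subset_univ B) fun _ _ _ => (Real.exp_pos _).le)
    have := (Finset.mem_filter.1 hf).2
    gcongr
  have h2 : ∑ f : ι → β, Real.exp (4 * ε * ∑ i ∈ S, cind (A i) (f i)) =
      ∏ i, ∑ z : β, (if i ∈ S then Real.exp (4 * ε * cind (A i) z) else 1) := by
    rw [Finset.prod_univ_sum, Fintype.piFinset_univ]
    refine Finset.sum_congr rfl fun f _ => ?_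
    rw [Finset.prod_ite_mem, Finset.univ_inter, Finset.mul_sum, Real.exp_sum]
  have h3 : ∏ i, ∑ z : β, (if i ∈ S then Real.exp (4 * ε * cind (A i) z) else 1) ≤
      ∏ i : ι, (Fintype.card β * (if i ∈ S then Real.exp (2 * ε ^ 2) else 1)) := by
    refine Finset.prod_le_prod (fun i _ => Finset.sum_nonneg fun z _ => ?_) fun i _ => ?_
    · split_ifs
      · positivity
      · positivity
    · split_ifs with hi
      · refine (hoeff_unif (A i) (4 * ε)).trans (le_of_eq ?_)
        congr 2; ring
      · simp
  rw [Finset.prod_mul_distrib, Finset.prod_ite_mem, Finset.univ_inter, Finset.prod_const,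
    Finset.prod_const, ← Real.exp_nat_mul] at h3
  have h4 := h1.trans (h2.le.trans h3)
  rw [← le_div_iff₀ (Real.exp_pos _), mul_div_assoc, ← Real.exp_sub] at h4
  refine h4.trans (le_of_eq ?_)
  rw [Fintype.card_fun, Finset.card_univ]
  push_cast
  congr 2
  ring

lemma flat_max {α : Type} [Fintype α] [DecidableEq α] (K : ℕ) (hK : 0 < K)
    (hN : K ≤ Fintype.card α) (p : α → ℝ) (hp : IsProb p) (hpK : ∀ a, p a ≤ 1 / K) (g : α → ℝ) :
    ∃ S : Finset α, S.card = K ∧ ∑ a, p a * g a ≤ (1 / K) * ∑ a ∈ S, g a := by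
  have hne : (powersetCard K (univ : Finset α)).Nonempty := by
    rw [powersetCard_nonempty]; simpa using hN
  obtain ⟨S, hS, hmax⟩ := Finset.exists_max_image _ (fun S => ∑ a ∈ S, g a) hne
  have hc := (mem_powersetCard.1 hS).2
  refine ⟨S, hc, ?_⟩
  have hSne : S.Nonempty := by rw [← Finset.card_pos]; omega
  obtain ⟨b, hb, hmin⟩ := Finset.exists_min_image S g hSne
  have hout : ∀ a, a ∉ S → g a ≤ g b := by
    intro a ha
    have ha' : a ∉ S.erase b := fun h => ha (Finset.mem_of_mem_erase h)
    have := hmax (insert a (S.erase b)) (by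
      rw [mem_powersetCard]
      refine ⟨subset_univ _, ?_⟩
      rw [card_insert_of_notMem ha', card_erase_of_mem hb]; omega)
    rw [sum_insert ha', ← Finset.add_sum_erase S g hb] at this
    linarith
  have hK' : (0 : ℝ) < K := by exact_mod_cast hK
  have e1 : ∑ a, p a * g a = ∑ a, p a * (g a - g b) + g b := by
    simp only [mul_sub, Finset.sum_sub_distrib, ← Finset.sum_mul, hp.2]; ring
  have e2 : (1 / (K : ℝ)) * ∑ a ∈ S, g a = ∑ a ∈ S, (1 / (K : ℝ)) * (g a - g b) + g b := by
    rw [← Finset.mul_sum, Finset.sum_sub_distrib, Finset.sum_const, hc, nsmul_eq_mul]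
    field_simp; ring
  rw [e1, e2, ← Finset.sum_add_sum_compl S]
  have e3 : ∑ a ∈ S, p a * (g a - g b) ≤ ∑ a ∈ S, (1 / (K : ℝ)) * (g a - g b) :=
    Finset.sum_le_sum fun a ha => mul_le_mul_of_nonneg_right (hpK a) (by linarith [hmin a ha])
  have e4 : ∑ a ∈ Sᶜ, p a * (g a - g b) ≤ 0 :=
    Finset.sum_nonpos fun a ha => mul_nonpos_of_nonneg_of_nonpos (hp.1 a)
      (by linarith [hout a (by simpa using ha)])
  linarith

lemma block_minent {n t : ℕ} (p : (Fin t → BitStr n) → ℝ) (k : ℕ) (hp : IsProb p)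
    (hb : IsBlockSourceT p (k : ℝ)) (x : Fin t → BitStr n) : p x ≤ 1 / ((2 ^ (t * k) : ℕ) : ℝ) := by
  have key : ∀ i : ℕ, i ≤ t → prefixProb p i x ≤ ((2 : ℝ) ^ (-(k : ℝ))) ^ i := by
    intro i
    induction i with
    | zero => intro _; simp [prefixProb, hp.2]
    | succ i ih =>
      intro hi
      have ih := ih (by omega)
      have hpos : (0 : ℝ) ≤ 2 ^ (-(k : ℝ)) := by positivity
      by_cases h0 : prefixProb p i x = 0
      · have : prefixProb p (i + 1) x ≤ prefixProb p i x := by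
          unfold prefixProb
          refine Finset.sum_le_sum fun x' _ => ?_
          split_ifs with h1 h2 h2
          · exact le_rfl
          · exact absurd (fun j hj => h1 j (by omega)) h2
          · exact hp.1 _
          · exact le_rfl
        rw [h0] at this
        exact this.trans (by positivity)
      · have := hb ⟨i, by omega⟩ x h0
        refine this.trans ?_
        rw [pow_succ']
        exact mul_le_mul_of_nonneg_left ih hpos
  have h := key t le_rfl
  have e : prefixProb p t x = p x := by
    unfold prefixProb
    have : ∀ x' : Fin t → BitStr n, (∀ j : Fin t, (j : ℕ) < t → x' j = x j) ↔ x' = x :=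
      fun x' => ⟨fun h => funext fun j => h j j.2, fun h => by simp [h]⟩
    simp only [this, Finset.sum_ite_eq', Finset.mem_univ, if_true]
  rw [e] at h
  refine h.trans (le_of_eq ?_)
  rw [Real.rpow_neg (by norm_num), Real.rpow_natCast]
  push_cast
  rw [inv_pow, ← pow_mul, one_div, mul_comm]

/-- slice of a test -/
def sl {α β : Type} [Fintype β] [DecidableEq α] [DecidableEq β] (T : Finset (β × α)) (y : α) :
    Finset β := univ.filter fun z => (z, y) ∈ T

lemma bad_count {α β : Type} [Fintype α] [DecidableEq α] [Fintype β] [DecidableEq β] [Nonempty β]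
    (K : ℕ) (ε : ℝ) (hε : 0 ≤ ε) (π : α × α → α) (σ : Finset α → Finset α → Finset α)
    (hσ : ∀ S1 S2 : Finset α, S1.card = K → S2.card = K → (σ S1 S2).card = K)
    (hπ : ∀ S1 S2 : Finset α, ∀ i ∈ S1 ×ˢ S2, π i ∈ σ S1 S2) :
    ∃ Bad : Finset (α × α → β),
      (Bad.card : ℝ) ≤ (Fintype.card α : ℝ) ^ (2 * K) * 2 ^ (Fintype.card β * K) *
        (Fintype.card (α × α → β) * Real.exp (- (2 * ε ^ 2 * (K : ℝ) ^ 2))) ∧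
      ∀ f, f ∉ Bad → ∀ S1 S2 : Finset α, S1.card = K → S2.card = K → ∀ T : Finset (β × α),
        ∑ x ∈ S1, ∑ y ∈ S2, cind (sl T (π (x, y))) (f (x, y)) ≤ ε * (K : ℝ) ^ 2 := by
  classical
  set P := powersetCard K (univ : Finset α) with hP
  set r : ℝ := Fintype.card (α × α → β) * Real.exp (- (2 * ε ^ 2 * (K : ℝ) ^ 2)) with hr
  have hr0 : 0 ≤ r := by positivity
  let bad1 : Finset α → Finset α → Finset (β × α) → Finset (α × α → β) := fun S1 S2 T =>
    univ.filter fun f => ε * ((S1 ×ˢ S2).card : ℝ) < ∑ i ∈ S1 ×ˢ S2, cind (sl T (π i)) (f i)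
  have hb1 : ∀ S1 ∈ P, ∀ S2 ∈ P, ∀ T, (bad1 S1 S2 T).card ≤ ⌊r⌋₊ := by
    intro S1 h1 S2 h2 T
    refine Nat.le_floor ?_
    have := count_bad (fun i => sl T (π i)) (S1 ×ˢ S2) ε hε
    refine this.trans (le_of_eq ?_)
    rw [hr, card_product, (mem_powersetCard.1 h1).2, (mem_powersetCard.1 h2).2]
    push_cast
    rw [sq (K : ℝ)]
  refine ⟨P.biUnion fun S1 => P.biUnion fun S2 =>
    ((univ : Finset β) ×ˢ (σ S1 S2)).powerset.biUnion fun T => bad1 S1 S2 T, ?_, ?_⟩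
  · have hc : (P.biUnion fun S1 => P.biUnion fun S2 =>
      ((univ : Finset β) ×ˢ (σ S1 S2)).powerset.biUnion fun T => bad1 S1 S2 T).card ≤
        P.card * (P.card * (2 ^ (Fintype.card β * K) * ⌊r⌋₊)) := by
      refine card_biUnion_le_card_mul _ _ _ fun S1 h1 => ?_
      refine card_biUnion_le_card_mul _ _ _ fun S2 h2 => ?_
      refine (card_biUnion_le_card_mul _ _ _ fun T _ => hb1 S1 h1 S2 h2 T).trans (le_of_eq ?_)
      rw [card_powerset, card_product, hσ S1 S2 (mem_powersetCard.1 h1).2 (mem_powersetCard.1 h2).2,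
        card_univ]
    have hPc : P.card ≤ Fintype.card α ^ K := by
      rw [hP, card_powersetCard, card_univ]; exact Nat.choose_le_pow _ _
    have hPc' : (P.card : ℝ) ≤ (Fintype.card α : ℝ) ^ K := by exact_mod_cast hPc
    have hc' := (Nat.cast_le (α := ℝ)).2 hc
    refine hc'.trans ?_
    push_cast
    have hfl : (⌊r⌋₊ : ℝ) ≤ r := Nat.floor_le hr0
    calc (P.card : ℝ) * (P.card * (2 ^ (Fintype.card β * K) * ⌊r⌋₊))
        ≤ (Fintype.card α : ℝ) ^ K * ((Fintype.card α : ℝ) ^ K * (2 ^ (Fintype.card β * K) * r)) := by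
          gcongr
      _ = _ := by ring
  · intro f hf S1 S2 h1 h2 T
    by_contra hcon
    push Not at hcon
    apply hf
    refine mem_biUnion.2 ⟨S1, mem_powersetCard.2 ⟨subset_univ _, h1⟩, mem_biUnion.2
      ⟨S2, mem_powersetCard.2 ⟨subset_univ _, h2⟩, mem_biUnion.2
      ⟨T.filter fun a => a.2 ∈ σ S1 S2, ?_, ?_⟩⟩⟩
    · rw [mem_powerset]
      intro a ha
      simp only [mem_filter] at ha
      simp [ha.2]
    · refine mem_filter.2 ⟨mem_univ _, ?_⟩
      rw [card_product, h1, h2]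
      push_cast
      rw [← sq]
      refine hcon.trans_le (le_of_eq ?_)
      rw [← Finset.sum_product']
      refine Finset.sum_congr rfl fun i hi => ?_
      have := hπ S1 S2 i hi
      have e : sl (T.filter fun a => a.2 ∈ σ S1 S2) (π i) = sl T (π i) := by
        unfold sl; ext z; simp [this]
      rw [e]

lemma exists_good {α β : Type} [Fintype α] [DecidableEq α] [Fintype β] [DecidableEq β] [Nonempty β]
    (K : ℕ) (ε : ℝ) (hε : 0 ≤ ε)
    (hlt : 2 * ((Fintype.card α : ℝ) ^ (2 * K) * 2 ^ (Fintype.card β * K) *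
        Real.exp (- (2 * ε ^ 2 * (K : ℝ) ^ 2))) < 1) :
    ∃ f : α → α → β, ∀ S1 S2 : Finset α, S1.card = K → S2.card = K → ∀ T : Finset (β × α),
      ∑ x ∈ S1, ∑ y ∈ S2, cind (sl T y) (f x y) ≤ ε * (K : ℝ) ^ 2 ∧
      ∑ y ∈ S1, ∑ x ∈ S2, cind (sl T x) (f x y) ≤ ε * (K : ℝ) ^ 2 := by
  classical
  obtain ⟨B1, hB1, h1⟩ := bad_count (α := α) (β := β) K ε hε Prod.snd (fun _ S2 => S2)
    (fun _ _ _ h => h) (fun _ _ i hi => (mem_product.1 hi).2)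
  obtain ⟨B2, hB2, h2⟩ := bad_count (α := α) (β := β) K ε hε Prod.fst (fun S1 _ => S1)
    (fun _ _ h _ => h) (fun _ _ i hi => (mem_product.1 hi).1)
  have hpos : (0 : ℝ) < Fintype.card (α × α → β) := by exact_mod_cast Fintype.card_pos
  have hcard : ((B1 ∪ B2).card : ℝ) < Fintype.card (α × α → β) := by
    have : ((B1 ∪ B2).card : ℝ) ≤ B1.card + B2.card := by exact_mod_cast card_union_le _ _
    nlinarith
  have hcard' : (B1 ∪ B2).card < Fintype.card (α × α → β) := by exact_mod_cast hcard
  obtain ⟨f, hf⟩ : ∃ f, f ∉ B1 ∪ B2 := by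
    by_contra hcon
    push Not at hcon
    rw [eq_univ_iff_forall.2 hcon, card_univ] at hcard'
    exact lt_irrefl _ hcard'
  rw [mem_union, not_or] at hf
  refine ⟨fun x y => f (x, y), fun S1 S2 c1 c2 T => ⟨h1 f hf.1 S1 S2 c1 c2 T, ?_⟩⟩
  rw [Finset.sum_comm]
  exact h2 f hf.2 S2 S1 c2 c1 T

lemma test_eq {α β : Type} [Fintype α] [DecidableEq α] [Fintype β] [DecidableEq β] [Nonempty β]
    (G : α → α → β) (p q : α → ℝ) (hp : IsProb p) (T : Finset (β × α)) :
    ∑ a ∈ T, (∑ x, if G x a.2 = a.1 then p x * q a.2 else 0) - ∑ a ∈ T, unif β a.1 * q a.2 =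
      ∑ x, p x * ∑ y, q y * cind (sl T y) (G x y) := by
  have e1 : ∑ a ∈ T, (∑ x, if G x a.2 = a.1 then p x * q a.2 else 0) =
      ∑ x, p x * ∑ y, q y * (if G x y ∈ sl T y then 1 else 0) := by
    rw [Finset.sum_comm]
    refine Finset.sum_congr rfl fun x _ => ?_
    rw [← Finset.univ_inter T, ← Finset.sum_ite_mem, Fintype.sum_prod_type_right, Finset.mul_sum]
    refine Finset.sum_congr rfl fun y _ => ?_
    rw [Finset.sum_eq_single (G x y)]
    · simp [sl]
    · intro z _ hz
      simp [hz.symm]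
    · simp
  have e2 : ∑ a ∈ T, unif β a.1 * q a.2 =
      ∑ x, p x * ∑ y, q y * (((sl T y).card : ℝ) / Fintype.card β) := by
    rw [← Finset.sum_mul, hp.2, one_mul]
    rw [← Finset.univ_inter T, ← Finset.sum_ite_mem, Fintype.sum_prod_type_right]
    refine Finset.sum_congr rfl fun y _ => ?_
    rw [← Finset.sum_filter]
    simp only [unif, Finset.sum_const, nsmul_eq_mul, sl, Finset.univ_inter]
    ring
  rw [e1, e2, ← Finset.sum_sub_distrib]
  refine Finset.sum_congr rfl fun x _ => ?_
  rw [← mul_sub, ← Finset.sum_sub_distrib]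
  simp only [cind, mul_sub]

lemma cind_compl {α β : Type} [Fintype α] [DecidableEq α] [Fintype β] [DecidableEq β] [Nonempty β]
    (T : Finset (β × α)) (y : α) (z : β) : cind (sl Tᶜ y) z = - cind (sl T y) z := by
  have e : sl Tᶜ y = (sl T y)ᶜ := by ext; simp [sl]
  have hM : (Fintype.card β : ℝ) ≠ 0 := by exact_mod_cast Fintype.card_ne_zero
  rw [e]
  unfold cind
  rw [Finset.card_compl, Nat.cast_sub (Finset.card_le_univ _), sub_div, div_self hM]
  by_cases h : z ∈ sl T y <;> simp [h]

lemma statDist_le {α β : Type} [Fintype α] [DecidableEq α] [Fintype β] [DecidableEq β] [Nonempty β]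
    (G : α → α → β) (p q : α → ℝ) (hp : IsProb p) (hq : IsProb q) (K : ℕ) (hK : 0 < K)
    (hpK : ∀ a, p a ≤ 1 / (K : ℝ)) (hqK : ∀ a, q a ≤ 1 / (K : ℝ)) (ε : ℝ)
    (hG : ∀ S1 S2 : Finset α, S1.card = K → S2.card = K → ∀ T : Finset (β × α),
      ∑ x ∈ S1, ∑ y ∈ S2, cind (sl T y) (G x y) ≤ ε * (K : ℝ) ^ 2) :
    statDist (fun z : β × α => ∑ x, if G x z.2 = z.1 then p x * q z.2 else 0)
      (fun z => unif β z.1 * q z.2) ≤ ε := by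
  have hK' : (0 : ℝ) < K := by exact_mod_cast hK
  have hN : K ≤ Fintype.card α := by
    have : ∑ a, p a ≤ ∑ _a : α, 1 / (K : ℝ) := Finset.sum_le_sum fun a _ => hpK a
    rw [hp.2, Finset.sum_const, nsmul_eq_mul, card_univ, mul_one_div, le_div_iff₀ hK', one_mul] at this
    exact_mod_cast this
  have key : ∀ T : Finset (β × α), ∑ x, p x * ∑ y, q y * cind (sl T y) (G x y) ≤ ε := by
    intro T
    obtain ⟨S1, c1, h1⟩ := flat_max K hK hN p hp hpK (fun x => ∑ y, q y * cind (sl T y) (G x y))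
    refine h1.trans ?_
    rw [Finset.sum_comm]
    simp only [← Finset.mul_sum]
    obtain ⟨S2, c2, h2⟩ := flat_max K hK hN q hq hqK (fun y => ∑ x ∈ S1, cind (sl T y) (G x y))
    have h3 := hG S1 S2 c1 c2 T
    rw [Finset.sum_comm] at h3
    calc _ ≤ 1 / (K : ℝ) * (1 / (K : ℝ) * ∑ y ∈ S2, ∑ x ∈ S1, cind (sl T y) (G x y)) := by gcongr
      _ ≤ 1 / (K : ℝ) * (1 / (K : ℝ) * (ε * (K : ℝ) ^ 2)) := by gcongr
      _ = ε := by field_simp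
  refine ciSup_le fun T => ?_
  rw [test_eq G p q hp T, abs_le]
  refine ⟨?_, key T⟩
  have := key Tᶜ
  simp only [cind_compl, mul_neg, Finset.sum_neg_distrib] at this
  linarith

lemma n_bound (η : ℝ) (hη : 0 < η) (n k : ℕ) (hk : 2 ≤ k)
    (h : Real.logb 2 n ^ ((2 : ℝ) + η) ≤ (k : ℝ)) : n ≤ 2 ^ (k - 1) := by
  by_contra hcon
  push Not at hcon
  have hn2 : 2 < n := lt_of_le_of_lt (by simpa using Nat.pow_le_pow_right (n := 2) (by norm_num) (show 1 ≤ k - 1 by omega)) hcon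
  have hn0 : (0 : ℝ) < n := by exact_mod_cast (by omega : 0 < n)
  have hL1 : (1 : ℝ) ≤ Real.logb 2 n := by
    rw [Real.le_logb_iff_rpow_le (by norm_num) hn0]
    rw [Real.rpow_one]; exact_mod_cast hn2.le
  have hL2 : Real.logb 2 n ^ 2 ≤ (k : ℝ) := by
    refine le_trans ?_ h
    rw [← Real.rpow_natCast]
    exact Real.rpow_le_rpow_of_exponent_le hL1 (by push_cast; linarith)
  rcases Nat.lt_or_ge k 3 with h3 | h3
  · have : k = 2 := by omega
    subst this
    have h15 : (3 / 2 : ℝ) ≤ Real.logb 2 n := by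
      have e : Real.logb 2 ((n : ℝ) ^ 2) = 2 * Real.logb 2 n := by
        rw [Real.logb_pow]; norm_num
      have : (3 : ℝ) ≤ Real.logb 2 ((n : ℝ) ^ 2) := by
        rw [Real.le_logb_iff_rpow_le (by norm_num) (by positivity)]
        have : (3 : ℝ) ≤ n := by exact_mod_cast hn2
        norm_num
        nlinarith
      linarith
    norm_num at hL2
    nlinarith
  · have hlt : (k : ℝ) - 1 ≤ Real.logb 2 n := by
      rw [Real.le_logb_iff_rpow_le (by norm_num) hn0]
      have : ((2 ^ (k - 1) : ℕ) : ℝ) ≤ n := by exact_mod_cast hcon.le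
      refine le_trans (le_of_eq ?_) this
      have e : (k : ℝ) - 1 = ((k - 1 : ℕ) : ℝ) := by
        rw [Nat.cast_sub (by omega), Nat.cast_one]
      rw [e, Real.rpow_natCast, Nat.cast_pow, Nat.cast_ofNat]
    have : (3 : ℝ) ≤ k := by exact_mod_cast h3
    nlinarith

lemma numeric (n k t : ℕ) (hk : 2 ≤ k) (ht : 2 ≤ t) (hn : n ≤ 2 ^ (k - 1)) (ε : ℝ)
    (hε : ε = (2 : ℝ) ^ (-(k : ℝ) ^ (1 / 20 : ℝ))) :
    2 * ((((2 ^ (t * n) : ℕ) : ℝ)) ^ (2 * 2 ^ (t * k)) * 2 ^ (2 ^ (9 * k / 10) * 2 ^ (t * k)) *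
        Real.exp (- (2 * ε ^ 2 * ((2 ^ (t * k) : ℕ) : ℝ) ^ 2))) < 1 := by
  obtain ⟨s, rfl⟩ : ∃ s, t = s + 2 := ⟨t - 2, by omega⟩
  obtain ⟨j, rfl⟩ : ∃ j, k = j + 1 := ⟨k - 1, by omega⟩
  have hj : 1 ≤ j := by omega
  simp only [Nat.add_sub_cancel] at hn
  set K : ℕ := 2 ^ ((s + 2) * (j + 1)) with hKdef
  set Q : ℕ := 2 ^ ((s + 1) * (j + 1)) with hQdef
  have hKQ : K = Q * (2 * 2 ^ j) := by
    rw [hKdef, hQdef, ← pow_succ', ← pow_add]; congr 1; ring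
  have hm : 2 ^ (9 * (j + 1) / 10) ≤ 2 ^ j := Nat.pow_le_pow_right (by norm_num) (by omega)
  have hs : s + 1 ≤ 2 ^ (s * (j + 1)) := by
    calc s + 1 ≤ 2 ^ s := Nat.lt_two_pow_self
      _ ≤ _ := Nat.pow_le_pow_right (by norm_num) (by nlinarith)
  have hQ : Q = 2 ^ (s * (j + 1)) * (2 * 2 ^ j) := by
    rw [hQdef, ← pow_succ', ← pow_add]; congr 1; ring
  -- main exponent bound: 2 * E ≤ 5 * Q
  have hE : 2 * (2 * ((s + 2) * n) + 2 ^ (9 * (j + 1) / 10)) ≤ 5 * Q := by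
    rw [hQ]
    have h1 : (s + 2) * n ≤ (s + 2) * 2 ^ j := Nat.mul_le_mul_left _ hn
    have h2 : (s + 1) * 2 ^ j ≤ 2 ^ (s * (j + 1)) * 2 ^ j := Nat.mul_le_mul_right _ hs
    have h3 : 1 * 2 ^ j ≤ 2 ^ (s * (j + 1)) * 2 ^ j := Nat.mul_le_mul_right _ Nat.one_le_two_pow
    nlinarith
  set E : ℕ := 2 * ((s + 2) * n) + 2 ^ (9 * (j + 1) / 10) with hEdef
  have hlhs : (((2 ^ ((s + 2) * n) : ℕ) : ℝ)) ^ (2 * K) * 2 ^ (2 ^ (9 * (j + 1) / 10) * K)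
      = 2 ^ (E * K) := by
    push_cast
    rw [← pow_mul, ← pow_add]; congr 1; rw [hEdef]; ring
  rw [hlhs]
  have hexp : (2 : ℝ) * (2 ^ (E * K) * Real.exp (- (2 * ε ^ 2 * (K : ℝ) ^ 2))) =
      Real.exp ((1 + E * K) * Real.log 2 - 2 * ε ^ 2 * (K : ℝ) ^ 2) := by
    rw [sub_eq_add_neg, Real.exp_add, ← mul_assoc, ← pow_succ', mul_comm ((1 : ℝ) + _),
      Real.exp_mul, Real.exp_log (by norm_num)]
    congr 1
    rw [← Real.rpow_natCast]; push_cast; congr 1; ring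
  rw [hexp, Real.exp_lt_one_iff]
  -- lower bound on ε ^ 2 * 2 ^ j
  have hpow : ((j + 1 : ℕ) : ℝ) ^ (1 / 20 : ℝ) ≤ 1 + j / 20 := by
    have := rpow_one_add_le_one_add_mul_self (s := (j : ℝ)) (by linarith [(Nat.cast_nonneg j : (0:ℝ) ≤ j)])
      (p := 1 / 20) (by norm_num) (by norm_num)
    push_cast
    rw [add_comm (j : ℝ) 1]
    linarith
  have hj' : (1 : ℝ) ≤ j := by exact_mod_cast hj
  have h186 : (1.86 : ℝ) ≤ 2 ^ (9 / 10 : ℝ) := by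
    have : (1.86 : ℝ) = (1.86 ^ (10 : ℕ)) ^ ((10 : ℕ) : ℝ)⁻¹ := by
      rw [Real.pow_rpow_inv_natCast (by norm_num) (by norm_num)]
    rw [this, show (9 / 10 : ℝ) = ((9 : ℕ) : ℝ) * ((10 : ℕ) : ℝ)⁻¹ by norm_num,
      Real.rpow_mul (by norm_num), Real.rpow_natCast]
    exact Real.rpow_le_rpow (by norm_num) (by norm_num) (by norm_num)
  have heps : (1.86 : ℝ) ≤ 4 * ε ^ 2 * 2 ^ j := by
    refine h186.trans ?_
    have : 4 * ε ^ 2 * 2 ^ j = (2 : ℝ) ^ (2 + 2 * (-((j + 1 : ℕ) : ℝ) ^ (1 / 20 : ℝ)) + j) := by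
      rw [Real.rpow_add (by norm_num), Real.rpow_add (by norm_num), hε, Real.rpow_natCast, mul_comm (2 : ℝ) (-_),
        Real.rpow_mul (by norm_num)]
      norm_num
    rw [this]
    refine Real.rpow_le_rpow_of_exponent_le (by norm_num) ?_
    linarith
  have hK16 : (16 : ℝ) ≤ K := by
    have : 2 ^ 4 ≤ K := Nat.pow_le_pow_right (by norm_num) (by nlinarith)
    exact_mod_cast this
  have hQ4 : (4 : ℝ) ≤ Q := by
    have : 2 ^ 2 ≤ Q := Nat.pow_le_pow_right (by norm_num) (by nlinarith)
    exact_mod_cast this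
  have hER : 2 * (E : ℝ) ≤ 5 * Q := by exact_mod_cast hE
  have hKQR : (K : ℝ) = Q * (2 * 2 ^ j) := by exact_mod_cast hKQ
  have hlog := Real.log_two_lt_d9
  have hlog0 : 0 < Real.log 2 := Real.log_pos (by norm_num)
  have hA : (1 + (E : ℝ) * K) ≤ 2.6 * (Q * K) := by nlinarith
  have hB : 1.86 * ((Q : ℝ) * K) ≤ 2 * ε ^ 2 * (K : ℝ) ^ 2 := by
    have : 2 * ε ^ 2 * (K : ℝ) ^ 2 = (4 * ε ^ 2 * 2 ^ j) * (Q * K) := by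
      rw [sq (K : ℝ)]; nth_rewrite 1 [hKQR]; ring
    rw [this]
    gcongr
  have hQK : (64 : ℝ) ≤ Q * K := by nlinarith
  have hC : (1 + (E : ℝ) * K) * Real.log 2 ≤ 2.6 * (Q * K) * 0.7 := by
    gcongr; linarith
  linarith

/-- For every constant `η > 0` there is `c > 0` such that for all `n, k`
with `k ≥ (log₂ n)^{2+η}`, with `t = ⌈7/η⌉ + 1` there is a function
`BExt : ({0,1}ⁿ)ᵗ × ({0,1}ⁿ)ᵗ → {0,1}^m`, `m = ⌊0.9k⌋`, such that for all independent
`t`-block `(k,…,k)` block sources `X` and `Y`, `|(BExt(X,Y), Y) − (U_m, Y)| ≤ ε` and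
`|(BExt(X,Y), X) − (U_m, X)| ≤ ε` where `ε = 2^{−k^c}`. -/
theorem block_source_extractor :
    ∀ η : ℝ, 0 < η →
      ∃ c : ℝ, 0 < c ∧
        ∀ n k : ℕ, Real.logb 2 n ^ ((2 : ℝ) + η) ≤ (k : ℝ) →
          ∃ BExt : (Fin (⌈(7 : ℝ) / η⌉₊ + 1) → BitStr n) →
              (Fin (⌈(7 : ℝ) / η⌉₊ + 1) → BitStr n) → BitStr (9 * k / 10),
            ∀ pX pY : (Fin (⌈(7 : ℝ) / η⌉₊ + 1) → BitStr n) → ℝ,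
              IsProb pX → IsProb pY →
              IsBlockSourceT pX (k : ℝ) → IsBlockSourceT pY (k : ℝ) →
              statDist
                  (fun z : BitStr (9 * k / 10) × (Fin (⌈(7 : ℝ) / η⌉₊ + 1) → BitStr n) =>
                    ∑ x, if BExt x z.2 = z.1 then pX x * pY z.2 else 0)
                  (fun z => unif (BitStr (9 * k / 10)) z.1 * pY z.2)
                ≤ (2 : ℝ) ^ (-(k : ℝ) ^ c) ∧
              statDist
                  (fun z : BitStr (9 * k / 10) × (Fin (⌈(7 : ℝ) / η⌉₊ + 1) → BitStr n) =>
                    ∑ y, if BExt z.2 y = z.1 then pX z.2 * pY y else 0)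
                  (fun z => unif (BitStr (9 * k / 10)) z.1 * pX z.2)
                ≤ (2 : ℝ) ^ (-(k : ℝ) ^ c) := by
  intro η hη
  refine ⟨1 / 20, by norm_num, fun n k hnk => ?_⟩
  have ht : 2 ≤ ⌈(7 : ℝ) / η⌉₊ + 1 := by
    have : 0 < ⌈(7 : ℝ) / η⌉₊ := Nat.ceil_pos.2 (by positivity)
    omega
  generalize ⌈(7 : ℝ) / η⌉₊ + 1 = t at ht ⊢
  rcases Nat.lt_or_ge k 2 with hk | hk
  · have hm : 9 * k / 10 = 0 := by omega
    generalize 9 * k / 10 = m at hm ⊢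
    subst hm
    refine ⟨fun _ _ => default, fun pX pY hX hY _ _ => ?_⟩
    have hu : ∀ z : BitStr 0, unif (BitStr 0) z = 1 := fun z => by simp [unif]
    have hd : ∀ z : BitStr 0, ((default : BitStr 0) = z) = True :=
      fun z => eq_true (Subsingleton.elim _ _)
    constructor
    · refine ciSup_le fun T => ?_
      simp only [hd, if_true, hu, one_mul, ← Finset.sum_mul,
        hX.2, sub_self, abs_zero]
      positivity
    · refine ciSup_le fun T => ?_
      simp only [hd, if_true, hu, one_mul, ← Finset.mul_sum,
        hY.2, mul_one, sub_self, abs_zero]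
      positivity
  · have hn := n_bound η hη n k hk hnk
    set ε : ℝ := (2 : ℝ) ^ (-(k : ℝ) ^ (1 / 20 : ℝ)) with hε
    have hnum := numeric n k t hk ht hn ε hε
    have hcα : Fintype.card (Fin t → BitStr n) = 2 ^ (t * n) := by
      simp [← pow_mul, mul_comm]
    have hcβ : Fintype.card (BitStr (9 * k / 10)) = 2 ^ (9 * k / 10) := by simp
    obtain ⟨f, hf⟩ := exists_good (α := Fin t → BitStr n) (β := BitStr (9 * k / 10))
      (2 ^ (t * k)) ε (by positivity) (by rw [hcα, hcβ]; exact hnum)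
    refine ⟨f, fun pX pY hX hY bX bY => ⟨?_, ?_⟩⟩
    · exact statDist_le f pX pY hX hY (2 ^ (t * k)) (by positivity) (block_minent pX k hX bX)
        (block_minent pY k hY bY) ε fun S1 S2 c1 c2 T => (hf S1 S2 c1 c2 T).1
    · have := statDist_le (fun y x => f x y) pY pX hY hX (2 ^ (t * k)) (by positivity)
        (block_minent pY k hY bY) (block_minent pX k hX bX) ε
        fun S1 S2 c1 c2 T => (hf S1 S2 c1 c2 T).2
      refine le_trans (le_of_eq ?_) this
      congr 1
      funext z
      refine Finset.sum_congr rfl fun y _ => ?_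
      rw [mul_comm (pX z.2)]
end

section
/- For every constant η > 0 there is a constant c > 0 such that for all n, k ∈ ℕ with k ≥ (log₂ n)^{2+η}, letting t = ⌈14/η⌉ + 2, there exists a function IExt : ({0,1}^n)^t → {0,1}^m with m = ⌊0.9k⌋ such that for all t mutually independent (n,k)-sources X₁,…,X_t, one has |IExt(X₁,…,X_t) − U_m| ≤ 2^{−k^c}. -/
open Finset

/-- deviation of the indicator of `T` -/
noncomputable def devi {V : Type*} [Fintype V] [DecidableEq V] (T : Finset V) (v : V) : ℝ :=
  (if v ∈ T then 1 else 0) - (T.card : ℝ) * (Fintype.card V : ℝ)⁻¹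

lemma devi_sum {V : Type*} [Fintype V] [DecidableEq V] [Nonempty V] (T : Finset V) :
    ∑ v, devi T v = 0 := by
  have : (Fintype.card V : ℝ) ≠ 0 := by exact_mod_cast Fintype.card_ne_zero
  simp only [devi, Finset.sum_sub_distrib, Finset.sum_ite_mem, Finset.univ_inter, Finset.sum_const,
    Finset.card_univ, nsmul_eq_mul]
  field_simp
  ring

lemma devi_abs {V : Type*} [Fintype V] [DecidableEq V] [Nonempty V] (T : Finset V) (v : V) :
    |devi T v| ≤ 1 := by
  have h0 : (0 : ℝ) < Fintype.card V := by exact_mod_cast Fintype.card_pos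
  have h1 : (T.card : ℝ) * (Fintype.card V : ℝ)⁻¹ ≤ 1 := by
    rw [← div_eq_mul_inv, div_le_one h0]
    exact_mod_cast Finset.card_le_univ T
  have h2 : 0 ≤ (T.card : ℝ) * (Fintype.card V : ℝ)⁻¹ := by positivity
  unfold devi
  rw [abs_le]
  split_ifs <;> constructor <;> linarith

lemma mgf_one {V : Type*} [Fintype V] [DecidableEq V] [Nonempty V] (T : Finset V) (l : ℝ)
    (h0 : 0 ≤ l) (h1 : l ≤ 1) :
    ∑ v, Real.exp (l * devi T v) ≤ Fintype.card V * Real.exp (l ^ 2) := by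
  have hb : ∀ v, Real.exp (l * devi T v) ≤ 1 + l * devi T v + l ^ 2 := by
    intro v
    have ha := devi_abs T v
    have hx : |l * devi T v| ≤ 1 := by
      rw [abs_mul, abs_of_nonneg h0]
      nlinarith [abs_nonneg (devi T v)]
    have h := (abs_le.1 (Real.abs_exp_sub_one_sub_id_le hx)).2
    have hs : (devi T v) ^ 2 ≤ 1 := by
      rw [← sq_abs]; nlinarith [abs_nonneg (devi T v)]
    have : (l * devi T v) ^ 2 ≤ l ^ 2 := by
      rw [mul_pow]; nlinarith [sq_nonneg l]
    linarith
  calc ∑ v, Real.exp (l * devi T v) ≤ ∑ v, (1 + l * devi T v + l ^ 2) :=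
        Finset.sum_le_sum fun v _ => hb v
    _ = Fintype.card V * (1 + l ^ 2) := by
        rw [Finset.sum_add_distrib, Finset.sum_add_distrib, ← Finset.mul_sum, devi_sum]
        simp; ring
    _ ≤ _ := by
        gcongr
        linarith [Real.add_one_le_exp (l ^ 2)]

lemma mgf_all {A V : Type*} [Fintype A] [DecidableEq A] [Fintype V] [DecidableEq V] [Nonempty V]
    (P : Finset A) (T : Finset V) (l : ℝ) (h0 : 0 ≤ l) (h1 : l ≤ 1) :
    ∑ g : A → V, Real.exp (l * ∑ x ∈ P, devi T (g x)) ≤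
      (Fintype.card V : ℝ) ^ Fintype.card A * Real.exp (l ^ 2 * P.card) := by
  have e1 : ∀ g : A → V, Real.exp (l * ∑ x ∈ P, devi T (g x)) =
      ∏ x, (if x ∈ P then Real.exp (l * devi T (g x)) else 1) := by
    intro g
    rw [Finset.prod_ite_mem, Finset.univ_inter, ← Real.exp_sum, Finset.mul_sum]
  simp_rw [e1]
  have e2 := Finset.prod_univ_sum (fun _ : A => (Finset.univ : Finset V))
    (fun x v => (if x ∈ P then Real.exp (l * devi T v) else 1 : ℝ))
  rw [Fintype.piFinset_univ] at e2
  rw [← e2]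
  calc _ ≤ ∏ x : A, ((Fintype.card V : ℝ) * (if x ∈ P then Real.exp (l ^ 2) else 1)) := by
        apply Finset.prod_le_prod
        · intro x _
          apply Finset.sum_nonneg
          intro v _
          split_ifs <;> positivity
        · intro x _
          split_ifs
          · exact mgf_one T l h0 h1
          · simp
    _ = _ := by
        rw [Finset.prod_mul_distrib, Finset.prod_ite_mem, Finset.univ_inter, Finset.prod_const,
          Finset.prod_const, Finset.card_univ, ← Real.exp_nat_mul]
        congr 2
        ring

lemma exists_good_s3 {A V : Type*} [Fintype A] [DecidableEq A] [Fintype V] [DecidableEq V] [Nonempty V]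
    (I : Finset (Finset A × Finset V)) (L : ℕ) (hL : ∀ i ∈ I, i.1.card = L) (e : ℝ)
    (he0 : 0 ≤ e) (he1 : e ≤ 1) (hI : (I.card : ℝ) * Real.exp (-(e ^ 2 * L / 4)) < 1) :
    ∃ g : A → V, ∀ i ∈ I, ∑ x ∈ i.1, devi i.2 (g x) ≤ e * L := by
  by_contra hcon
  push Not at hcon
  have hV : (0 : ℝ) < (Fintype.card V : ℝ) ^ Fintype.card A := by
    have : 0 < Fintype.card V := Fintype.card_pos
    positivity
  have h1 : ((Fintype.card V : ℝ) ^ Fintype.card A) ≤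
      ∑ g : A → V, ∑ i ∈ I, Real.exp (e / 2 * (∑ x ∈ i.1, devi i.2 (g x)) + -(e ^ 2 * L / 2)) := by
    have : ((Fintype.card V : ℝ) ^ Fintype.card A) = ∑ g : A → V, (1 : ℝ) := by simp
    rw [this]
    apply Finset.sum_le_sum
    intro g _
    obtain ⟨i, hi, hlt⟩ := hcon g
    refine le_trans ?_ (Finset.single_le_sum
      (f := fun i : Finset A × Finset V =>
        Real.exp (e / 2 * (∑ x ∈ i.1, devi i.2 (g x)) + -(e ^ 2 * L / 2)))
      (fun _ _ => (Real.exp_pos _).le) hi)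
    apply Real.one_le_exp
    nlinarith
  rw [Finset.sum_comm] at h1
  have h2 : ∀ i ∈ I, ∑ g : A → V,
      Real.exp (e / 2 * (∑ x ∈ i.1, devi i.2 (g x)) + -(e ^ 2 * L / 2)) ≤
      (Fintype.card V : ℝ) ^ Fintype.card A * Real.exp (-(e ^ 2 * L / 4)) := by
    intro i hi
    simp_rw [Real.exp_add]
    rw [← Finset.sum_mul]
    have := mgf_all i.1 i.2 (e / 2) (by linarith) (by linarith)
    calc _ ≤ ((Fintype.card V : ℝ) ^ Fintype.card A * Real.exp ((e / 2) ^ 2 * i.1.card)) *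
          Real.exp (-(e ^ 2 * L / 2)) := by gcongr
      _ = _ := by
        rw [mul_assoc, ← Real.exp_add, hL i hi]
        congr 2
        ring
  have h3 := h1.trans (Finset.sum_le_sum h2)
  rw [Finset.sum_const, nsmul_eq_mul] at h3
  nlinarith

lemma flat_le {α : Type*} [Fintype α] [DecidableEq α] (K : ℕ) (hK : 0 < K)
    (hKc : K ≤ Fintype.card α) (p : α → ℝ) (hp : IsProb p) (hb : ∀ a, p a ≤ (K : ℝ)⁻¹)
    (f : α → ℝ) : ∃ S : Finset α, S.card = K ∧ ∑ a, p a * f a ≤ (K : ℝ)⁻¹ * ∑ a ∈ S, f a := by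
  have hne : (Finset.powersetCard K (Finset.univ : Finset α)).Nonempty :=
    Finset.powersetCard_nonempty.2 (by simpa using hKc)
  obtain ⟨S, hS, hmax⟩ := Finset.exists_max_image _ (fun S => ∑ a ∈ S, f a) hne
  have hSc : S.card = K := (Finset.mem_powersetCard.1 hS).2
  have hSne : S.Nonempty := Finset.card_pos.1 (by omega)
  obtain ⟨s, hs, hmin⟩ := Finset.exists_min_image S f hSne
  refine ⟨S, hSc, ?_⟩
  have hout : ∀ a, a ∉ S → f a ≤ f s := by
    intro a ha
    have ha' : a ∉ S.erase s := fun h => ha (Finset.mem_of_mem_erase h)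
    have hmem : insert a (S.erase s) ∈ Finset.powersetCard K (Finset.univ : Finset α) := by
      rw [Finset.mem_powersetCard]
      refine ⟨Finset.subset_univ _, ?_⟩
      rw [Finset.card_insert_of_notMem ha', Finset.card_erase_of_mem hs]
      omega
    have h := hmax _ hmem
    rw [Finset.sum_insert ha', ← Finset.add_sum_erase S f hs] at h
    linarith
  have h1 : ∑ a, p a * (f a - f s) ≤ ∑ a, (if a ∈ S then (K : ℝ)⁻¹ * (f a - f s) else 0) := by
    apply Finset.sum_le_sum
    intro a _
    split_ifs with h
    · have := hmin a h
      have := hb a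
      gcongr
    · have := hout a h
      have := hp.1 a
      nlinarith
  rw [Finset.sum_ite_mem, Finset.univ_inter, ← Finset.mul_sum, Finset.sum_sub_distrib,
    Finset.sum_const, hSc, nsmul_eq_mul] at h1
  simp_rw [mul_sub] at h1
  rw [Finset.sum_sub_distrib, ← Finset.sum_mul, hp.2] at h1
  have : (K : ℝ)⁻¹ * (K * f s) = f s := by
    have : (K : ℝ) ≠ 0 := by positivity
    field_simp
  linarith

lemma statDist_le_s3 {V : Type*} [Fintype V] [DecidableEq V] (p q : V → ℝ) (hp : ∑ v, p v = 1)
    (hq : ∑ v, q v = 1) (b : ℝ) (h : ∀ T : Finset V, ∑ v ∈ T, p v - ∑ v ∈ T, q v ≤ b) :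
    statDist p q ≤ b := by
  apply ciSup_le
  intro T
  rw [abs_le]
  refine ⟨?_, h T⟩
  have h1 := h Tᶜ
  have h2 := Finset.sum_add_sum_compl T p
  have h3 := Finset.sum_add_sum_compl T q
  linarith

lemma unif_sum (V : Type*) [Fintype V] [Nonempty V] : ∑ v, unif V v = 1 := by
  have : (Fintype.card V : ℝ) ≠ 0 := by exact_mod_cast Fintype.card_ne_zero
  simp [unif, this]

lemma prod_sum_one {α : Type*} [Fintype α] (t : ℕ) (p : Fin t → α → ℝ)
    (hp : ∀ i, IsProb (p i)) : ∑ x : Fin t → α, ∏ i, p i (x i) = 1 := by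
  classical
  have e2 := Finset.prod_univ_sum (fun _ : Fin t => (Finset.univ : Finset α)) p
  rw [Fintype.piFinset_univ] at e2
  rw [← e2]
  exact Finset.prod_eq_one fun i _ => (hp i).2

lemma out_sum {α V : Type*} [Fintype α] [Fintype V] [DecidableEq V] (t : ℕ)
    (p : Fin t → α → ℝ) (F : (Fin t → α) → V) (T : Finset V) :
    ∑ v ∈ T, ∑ x : Fin t → α, (if F x = v then ∏ i, p i (x i) else 0) =
      ∑ x : Fin t → α, (if F x ∈ T then 1 else 0) * ∏ i, p i (x i) := by
  rw [Finset.sum_comm]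
  apply Finset.sum_congr rfl
  intro x _
  rw [Finset.sum_ite_eq]
  split_ifs <;> simp

lemma sum_fcons {α : Type*} [Fintype α] (t : ℕ) (H : (Fin (t + 1) → α) → ℝ) :
    ∑ x, H x = ∑ a, ∑ z : Fin t → α, H (Fin.cons a z) := by
  rw [← (Fin.consEquiv (fun _ : Fin (t + 1) => α)).sum_comp, Fintype.sum_prod_type]
  rfl

lemma sum_two {α : Type*} [Fintype α] (s : ℕ) (p : Fin (s + 2) → α → ℝ)
    (hp : ∀ i, IsProb (p i)) (H : α → α → ℝ) :
    ∑ x : Fin (s + 2) → α, H (x 0) (x 1) * ∏ i, p i (x i) =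
      ∑ a, p 0 a * ∑ b, p 1 b * H a b := by
  rw [sum_fcons]
  apply Finset.sum_congr rfl
  intro a _
  rw [sum_fcons, Finset.mul_sum]
  apply Finset.sum_congr rfl
  intro b _
  have h1 := prod_sum_one s (fun i => p i.succ.succ) (fun i => hp _)
  have e : ∀ z : Fin s → α,
      H ((Fin.cons a (Fin.cons b z : Fin (s + 1) → α) : Fin (s + 2) → α) 0)
        ((Fin.cons a (Fin.cons b z : Fin (s + 1) → α) : Fin (s + 2) → α) 1) *
      ∏ i, p i ((Fin.cons a (Fin.cons b z : Fin (s + 1) → α) : Fin (s + 2) → α) i) =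
      (p 0 a * (p 1 b * H a b)) * ∏ i, p i.succ.succ (z i) := by
    intro z
    rw [Fin.prod_univ_succ, Fin.prod_univ_succ]
    simp only [Fin.cons_zero, Fin.cons_succ]
    have : (Fin.cons a (Fin.cons b z : Fin (s + 1) → α) : Fin (s + 2) → α) 1 = b := rfl
    rw [this]
    have : (Fin.succ 0 : Fin (s + 2)) = 1 := rfl
    rw [this]
    ring
  simp_rw [e]
  rw [← Finset.mul_sum, h1, mul_one]

/-- Existence of a two-source extractor by the probabilistic method. -/
lemma main_case (n k m s : ℕ) (hkn : k ≤ n) (hmk : m ≤ k) (hn1 : 1 ≤ n) (e : ℝ) (he0 : 0 ≤ e)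
    (he1 : e ≤ 1) (hnk : 9 * (n : ℝ) ≤ e ^ 2 * 2 ^ k) :
    ∃ F : (Fin (s + 2) → BitStr n) → BitStr m,
      ∀ p : Fin (s + 2) → BitStr n → ℝ, (∀ i, IsProb (p i)) → (∀ i, IsKSource (p i) (k : ℝ)) →
        statDist (fun v : BitStr m =>
          ∑ x : Fin (s + 2) → BitStr n, if F x = v then ∏ i, p i (x i) else 0)
          (unif (BitStr m)) ≤ e := by
  classical
  set K : ℕ := 2 ^ k with hKdef
  have hK0 : 0 < K := by positivity
  have hK0' : (0 : ℝ) < K := by exact_mod_cast hK0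
  have hcard : Fintype.card (BitStr n) = 2 ^ n := by simp
  have hcardm : Fintype.card (BitStr m) = 2 ^ m := by simp
  let PS := Finset.powersetCard K (Finset.univ : Finset (BitStr n))
  let I : Finset (Finset (BitStr n × BitStr n) × Finset (BitStr m)) :=
    (PS ×ˢ PS ×ˢ (Finset.univ : Finset (Finset (BitStr m)))).image
      (fun q => (q.1 ×ˢ q.2.1, q.2.2))
  have hIcard : I.card ≤ 2 ^ (3 * n * K) := by
    have hPS : PS.card ≤ 2 ^ (n * K) := by
      rw [Finset.card_powersetCard, Finset.card_univ, hcard, pow_mul]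
      exact Nat.choose_le_pow _ _
    have hT : (Finset.univ : Finset (Finset (BitStr m))).card ≤ 2 ^ (n * K) := by
      rw [Finset.card_univ, Fintype.card_finset, hcardm]
      apply Nat.pow_le_pow_right (by norm_num)
      calc 2 ^ m ≤ 2 ^ k := Nat.pow_le_pow_right (by norm_num) hmk
        _ ≤ n * K := Nat.le_mul_of_pos_left _ hn1
    calc I.card ≤ _ := Finset.card_image_le
      _ = PS.card * (PS.card * (Finset.univ : Finset (Finset (BitStr m))).card) := by
        rw [Finset.card_product, Finset.card_product]
      _ ≤ 2 ^ (n * K) * (2 ^ (n * K) * 2 ^ (n * K)) := by gcongr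
      _ = 2 ^ (3 * n * K) := by rw [← pow_add, ← pow_add]; congr 1; ring
  have hL : ∀ i ∈ I, i.1.card = K * K := by
    intro i hi
    obtain ⟨q, hq, rfl⟩ := Finset.mem_image.1 hi
    simp only [Finset.mem_product] at hq
    rw [Finset.card_product, (Finset.mem_powersetCard.1 hq.1).2,
      (Finset.mem_powersetCard.1 hq.2.1).2]
  have hI : (I.card : ℝ) * Real.exp (-(e ^ 2 * ((K * K : ℕ) : ℝ) / 4)) < 1 := by
    have h1 : (I.card : ℝ) ≤ Real.exp (Real.log 2 * (3 * n * K)) := by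
      have : Real.exp (Real.log 2 * (3 * n * K)) = (2 : ℝ) ^ (3 * n * K) := by
        rw [← Real.rpow_natCast, Real.rpow_def_of_pos (by norm_num)]
        push_cast; rfl
      rw [this]
      exact_mod_cast hIcard
    calc _ ≤ Real.exp (Real.log 2 * (3 * n * K)) * Real.exp (-(e ^ 2 * ((K * K : ℕ) : ℝ) / 4)) := by
          gcongr
      _ < 1 := by
        rw [← Real.exp_add, Real.exp_lt_one_iff]
        have hl := Real.log_two_lt_d9
        have hnK : (0 : ℝ) < n * K := by positivity
        have : 9 * (n : ℝ) * K ≤ e ^ 2 * K * K := by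
          have : (K : ℝ) = 2 ^ k := by rw [hKdef]; push_cast; rfl
          rw [← this] at hnk
          gcongr
        push_cast
        nlinarith
  obtain ⟨g, hg⟩ := exists_good_s3 I (K * K) hL e he0 he1 hI
  refine ⟨fun x => g (x 0, x 1), ?_⟩
  intro p hp hk
  have hk' : ∀ i a, p i a ≤ (K : ℝ)⁻¹ := by
    intro i a
    have := hk i a
    rw [Real.rpow_neg (by norm_num), Real.rpow_natCast] at this
    rw [hKdef]; push_cast; exact this
  have hKc : K ≤ Fintype.card (BitStr n) := by
    rw [hcard]; exact Nat.pow_le_pow_right (by norm_num) hkn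
  apply statDist_le_s3
  · rw [out_sum]; simpa using prod_sum_one _ p hp
  · exact unif_sum _
  intro T
  rw [out_sum]
  have hu : ∑ v ∈ T, unif (BitStr m) v = (T.card : ℝ) * (Fintype.card (BitStr m) : ℝ)⁻¹ := by
    simp only [unif, Finset.sum_const, nsmul_eq_mul]
  have h1 : ∑ x : Fin (s + 2) → BitStr n,
      (if g (x 0, x 1) ∈ T then 1 else 0) * ∏ i, p i (x i) - ∑ v ∈ T, unif (BitStr m) v
      = ∑ a, p 0 a * ∑ b, p 1 b * devi T (g (a, b)) := by
    rw [← sum_two s p hp (fun a b => devi T (g (a, b)))]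
    simp only [devi, sub_mul, Finset.sum_sub_distrib]
    rw [← Finset.mul_sum, prod_sum_one _ p hp, hu, mul_one]
  rw [h1]
  obtain ⟨S1, hS1, hle1⟩ := flat_le K hK0 hKc (p 0) (hp 0) (hk' 0)
    (fun a => ∑ b, p 1 b * devi T (g (a, b)))
  obtain ⟨S2, hS2, hle2⟩ := flat_le K hK0 hKc (p 1) (hp 1) (hk' 1)
    (fun b => ∑ a ∈ S1, devi T (g (a, b)))
  have hmem : (S1 ×ˢ S2, T) ∈ I := by
    apply Finset.mem_image.2
    refine ⟨(S1, S2, T), ?_, rfl⟩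
    simp [PS, hS1, hS2]
  have h3 := hg _ hmem
  simp only [Finset.sum_product_right] at h3
  rw [Finset.sum_comm] at hle1
  simp_rw [← Finset.mul_sum] at hle1
  refine hle1.trans ?_
  calc _ ≤ (K : ℝ)⁻¹ * ((K : ℝ)⁻¹ * (e * ((K * K : ℕ) : ℝ))) := by
        gcongr
        exact hle2.trans (by gcongr)
    _ = e := by push_cast; field_simp

lemma not_source (n k : ℕ) (h : n < k) (p : BitStr n → ℝ) (hp : IsProb p)
    (hk : IsKSource p (k : ℝ)) : False := by
  have h1 : (1 : ℝ) ≤ ∑ a : BitStr n, (2 : ℝ) ^ (-(k : ℝ)) := by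
    rw [← hp.2]; exact Finset.sum_le_sum fun a _ => hk a
  rw [Finset.sum_const, Real.rpow_neg (by norm_num), Real.rpow_natCast, nsmul_eq_mul,
    Finset.card_univ] at h1
  simp only [Fintype.card_pi, Fintype.card_bool, Finset.prod_const, Finset.card_univ,
    Fintype.card_fin] at h1
  push_cast at h1
  rw [← div_eq_mul_inv, le_div_iff₀ (by positivity), one_mul] at h1
  exact absurd h1 (not_le.2 (pow_lt_pow_right₀ (by norm_num) h))

lemma source_eq (n : ℕ) (p : BitStr n → ℝ) (hp : IsProb p)
    (hk : IsKSource p (n : ℝ)) (a : BitStr n) : p a = ((2 : ℝ) ^ n)⁻¹ := by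
  have hk' : ∀ a, p a ≤ ((2 : ℝ) ^ n)⁻¹ := by
    intro a
    have := hk a
    rwa [Real.rpow_neg (by norm_num), Real.rpow_natCast] at this
  have h := (Finset.sum_eq_sum_iff_of_le (s := Finset.univ) (f := p)
    (g := fun _ => ((2 : ℝ) ^ n)⁻¹) (fun a _ => hk' a)).1 (by
      rw [hp.2]; simp)
  exact h a (Finset.mem_univ _)

lemma card_fiber (d m : ℕ) (T : Finset (BitStr m)) :
    ∑ a : BitStr (m + d), (if (fun i => a (Fin.castAdd d i)) ∈ T then (1 : ℝ) else 0) =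
      T.card * 2 ^ d := by
  rw [← (Fin.appendEquiv m d (α := Bool)).sum_comp, Fintype.sum_prod_type]
  simp [Fin.appendEquiv]

lemma unif_case (n m s : ℕ) (hmn : m ≤ n) (e : ℝ) (he0 : 0 ≤ e) :
    ∃ F : (Fin (s + 2) → BitStr n) → BitStr m,
      ∀ p : Fin (s + 2) → BitStr n → ℝ, (∀ i, IsProb (p i)) → (∀ i, IsKSource (p i) (n : ℝ)) →
        statDist (fun v : BitStr m =>
          ∑ x : Fin (s + 2) → BitStr n, if F x = v then ∏ i, p i (x i) else 0)
          (unif (BitStr m)) ≤ e := by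
  obtain ⟨d, rfl⟩ := Nat.exists_eq_add_of_le hmn
  refine ⟨fun x i => x 0 (Fin.castAdd d i), ?_⟩
  intro p hp hk
  apply statDist_le_s3
  · rw [out_sum]; simpa using prod_sum_one _ p hp
  · exact unif_sum _
  intro T
  rw [out_sum, sum_two s p hp
    (fun a _ => if (fun i => a (Fin.castAdd d i)) ∈ T then (1 : ℝ) else 0)]
  simp_rw [← Finset.sum_mul, (hp 1).2, one_mul, source_eq _ _ (hp 0) (hk 0)]
  rw [← Finset.mul_sum, card_fiber]
  simp only [unif, Finset.sum_const, nsmul_eq_mul]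
  simp only [Fintype.card_pi, Fintype.card_bool, Finset.prod_const, Finset.card_univ,
    Fintype.card_fin]
  push_cast
  rw [pow_add]
  have : ((2 : ℝ) ^ m * 2 ^ d)⁻¹ * (T.card * 2 ^ d) - T.card * ((2 : ℝ) ^ m)⁻¹ = 0 := by
    field_simp
    ring
  rw [this]; exact he0

lemma zero_case (n s : ℕ) (e : ℝ) (he0 : 0 ≤ e) (m : ℕ) (hm : m = 0) :
    ∃ F : (Fin (s + 2) → BitStr n) → BitStr m,
      ∀ p : Fin (s + 2) → BitStr n → ℝ, (∀ i, IsProb (p i)) →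
        statDist (fun v : BitStr m =>
          ∑ x : Fin (s + 2) → BitStr n, if F x = v then ∏ i, p i (x i) else 0)
          (unif (BitStr m)) ≤ e := by
  subst hm
  refine ⟨fun _ => default, fun p hp => ?_⟩
  apply statDist_le_s3
  · rw [out_sum]; simpa only [Finset.mem_univ, if_true, one_mul] using prod_sum_one _ p hp
  · exact unif_sum _
  intro T
  have h := prod_sum_one _ p hp
  have : ∀ v : BitStr 0, (∑ x : Fin (s + 2) → BitStr n,
      if (default : BitStr 0) = v then ∏ i, p i (x i) else 0) = unif (BitStr 0) v := by
    intro v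
    have hv : (default : BitStr 0) = v := Subsingleton.elim _ _
    simp only [if_pos hv, h]
    simp [unif]
  simp_rw [this]
  simpa using he0

lemma log_sq (η : ℝ) (hη : 0 < η) (n k : ℕ) (hn : 2 ≤ n)
    (h : Real.logb 2 n ^ ((2 : ℝ) + η) ≤ (k : ℝ)) :
    1 ≤ Real.logb 2 n ∧ Real.logb 2 n ^ 2 ≤ (k : ℝ) := by
  have h1 : 1 ≤ Real.logb 2 n := by
    rw [Real.le_logb_iff_rpow_le (by norm_num) (by positivity), Real.rpow_one]
    exact_mod_cast hn
  refine ⟨h1, le_trans ?_ h⟩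
  rw [← Real.rpow_natCast]
  exact Real.rpow_le_rpow_of_exponent_le h1 (by push_cast; linarith)

lemma small_eq (n k : ℕ) (hk2 : 2 ≤ k) (hk : k ≤ 15) (hkn : k < n)
    (h : Real.logb 2 n ^ 2 ≤ (k : ℝ)) : False := by
  have key : ∃ r : ℕ, 2 ^ r ≤ (k + 1) ^ 4 ∧ 16 * k < r ^ 2 := by
    have : ∃ r < 17, 2 ^ r ≤ (k + 1) ^ 4 ∧ 16 * k < r ^ 2 := by
      interval_cases k <;> decide
    obtain ⟨r, _, hr⟩ := this
    exact ⟨r, hr⟩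
  obtain ⟨r, hr1, hr2⟩ := key
  have hr3 : 2 ^ r ≤ n ^ 4 := hr1.trans (Nat.pow_le_pow_left (by omega) 4)
  have hn0 : (0 : ℝ) < n := by exact_mod_cast (by omega : 0 < n)
  have h4 : (r : ℝ) ≤ 4 * Real.logb 2 n := by
    have : (r : ℝ) ≤ Real.logb 2 ((n : ℝ) ^ 4) := by
      rw [Real.le_logb_iff_rpow_le (by norm_num) (by positivity), Real.rpow_natCast]
      exact_mod_cast hr3
    rw [Real.logb_pow] at this
    exact_mod_cast this
  have h5 : (16 : ℝ) * k < (r : ℝ) ^ 2 := by exact_mod_cast hr2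
  have h6 : (r : ℝ) ^ 2 ≤ (4 * Real.logb 2 n) ^ 2 := by gcongr
  nlinarith

/-- For every constant `η > 0` there is `c > 0` such that for all `n, k`
with `k ≥ (log₂ n)^{2+η}`, with `t = ⌈14/η⌉ + 2` there is an extractor
`IExt : ({0,1}ⁿ)ᵗ → {0,1}^m`, `m = ⌊0.9k⌋`, such that for all `t` mutually independent
`(n,k)`-sources `X₁, …, X_t`, `|IExt(X₁,…,X_t) − U_m| ≤ 2^{−k^c}`. -/
theorem constant_source_extractor :
    ∀ η : ℝ, 0 < η →
      ∃ c : ℝ, 0 < c ∧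
        ∀ n k : ℕ, Real.logb 2 n ^ ((2 : ℝ) + η) ≤ (k : ℝ) →
          ∃ IExt : (Fin (⌈(14 : ℝ) / η⌉₊ + 2) → BitStr n) → BitStr (9 * k / 10),
            ∀ pXs : Fin (⌈(14 : ℝ) / η⌉₊ + 2) → BitStr n → ℝ,
              (∀ i, IsProb (pXs i)) → (∀ i, IsKSource (pXs i) (k : ℝ)) →
              statDist
                  (fun v : BitStr (9 * k / 10) =>
                    ∑ x : Fin (⌈(14 : ℝ) / η⌉₊ + 2) → BitStr n,
                      if IExt x = v then ∏ i, pXs i (x i) else 0)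
                  (unif (BitStr (9 * k / 10)))
                ≤ (2 : ℝ) ^ (-(k : ℝ) ^ c) := by
  intro η hη
  refine ⟨1 / 2, by norm_num, ?_⟩
  intro n k h
  have he0 : (0 : ℝ) ≤ (2 : ℝ) ^ (-(k : ℝ) ^ ((1 : ℝ) / 2)) := by positivity
  rcases Nat.lt_or_ge k 2 with hk2 | hk2
  · obtain ⟨F, hF⟩ := zero_case n ⌈(14 : ℝ) / η⌉₊ _ he0 (9 * k / 10) (by omega)
    exact ⟨F, fun p hp _ => hF p hp⟩
  rcases Nat.lt_or_ge n k with hnk | hnk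
  · exact ⟨fun _ _ => false, fun p hp hk => (not_source n k hnk (p 0) (hp 0) (hk 0)).elim⟩
  obtain ⟨hl1, hl2⟩ := log_sq η hη n k (by omega) h
  rcases Nat.lt_or_ge 15 k with hk | hk
  · apply main_case n k _ _ hnk (by omega) (by omega) _ he0
    · apply Real.rpow_le_one_of_one_le_of_nonpos (by norm_num)
      simp only [Left.neg_nonpos_iff]
      positivity
    · rw [← Real.sqrt_eq_rpow]
      have hs : Real.sqrt k ^ 2 = k := Real.sq_sqrt (by positivity)
      have hs4 : 4 ≤ Real.sqrt k := by
        apply Real.le_sqrt_of_sq_le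
        norm_num
        exact_mod_cast hk
      have hn : (n : ℝ) ≤ 2 ^ Real.sqrt k := by
        have : Real.logb 2 n ≤ Real.sqrt k := Real.le_sqrt_of_sq_le hl2
        rwa [Real.logb_le_iff_le_rpow (by norm_num) (by exact_mod_cast (by omega : 0 < n))] at this
      have h9 : (9 : ℝ) ≤ 2 ^ (4 : ℝ) := by norm_num
      calc 9 * (n : ℝ) ≤ 2 ^ (4 : ℝ) * 2 ^ Real.sqrt k := by gcongr
        _ = 2 ^ (4 + Real.sqrt k) := by rw [← Real.rpow_add (by norm_num)]
        _ ≤ 2 ^ (-Real.sqrt k * 2 + k) := by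
          apply Real.rpow_le_rpow_of_exponent_le (by norm_num)
          nlinarith
        _ = _ := by
          rw [Real.rpow_add (by norm_num), Real.rpow_mul (by norm_num), Real.rpow_natCast]
          norm_cast
  · rcases Nat.eq_or_lt_of_le hnk with heq | hlt
    · subst heq
      exact unif_case k _ _ (by omega) _ he0
    · exact (small_eq n k hk2 hk hlt hl2).elim
end

section
/- For every constant η > 0 there exist constants C₀ > 1 and c > 0 such that for all n, k ∈ ℕ with n ≥ C₀ and k ≥ (1/2)·(log₂ n)^{2+η}, letting t = ⌈7/η⌉ + 1, there exists a function BExt : ({0,1}^n)^t × ({0,1}^n)^t → {0,1}^m with m = ⌊1.8k⌋ such that: for all independent X = (X₁,…,X_t) and Y = (Y₁,…,Y_t) that are each (2k,…,2k) block sources with t blocks of n bits, one has |(BExt(X,Y), Y) − (U_m, Y)| ≤ ε and |(BExt(X,Y), X) − (U_m, X)| ≤ ε, where ε = 2^{−k^c}. -/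
open Finset

/-- Chernoff plus union bound: a random function is good for all tests. -/
lemma exists_good_fun {Ω Z I : Type*} [Fintype Ω] [DecidableEq Ω] [Fintype Z] [Nonempty Z]
    (J : Finset I) (h : I → Ω → Z → ℝ) (W : I → Finset Ω) (ε D : ℝ) (hε0 : 0 ≤ ε) (hε1 : ε ≤ 1)
    (hb : ∀ i ∈ J, ∀ ω z, |h i ω z| ≤ 1) (hs : ∀ i ∈ J, ∀ ω, ∑ z, h i ω z = 0)
    (hW : ∀ i ∈ J, ∀ ω, ω ∉ W i → ∀ z, h i ω z = 0)
    (hD : ∀ i ∈ J, ((W i).card : ℝ) = D)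
    (hcard : (J.card : ℝ) * Real.exp (-(ε ^ 2 * D / 4)) < 1) :
    ∃ B : Ω → Z, ∀ i ∈ J, ∑ ω, h i ω (B ω) ≤ ε * D := by
  by_contra hcon
  push Not at hcon
  set lam : ℝ := ε / 2 with hlam
  have hM : (0 : ℝ) < Fintype.card Z := by exact_mod_cast Fintype.card_pos
  have key : ∀ i ∈ J, ∑ B : Ω → Z, Real.exp (lam * ∑ ω, h i ω (B ω))
      ≤ (Fintype.card Z : ℝ) ^ Fintype.card Ω * Real.exp (lam ^ 2 * D) := by
    intro i hi
    have h1 : ∑ B : Ω → Z, Real.exp (lam * ∑ ω, h i ω (B ω))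
        = ∏ ω, ∑ z, Real.exp (lam * h i ω z) := by
      rw [Finset.prod_univ_sum, Fintype.piFinset_univ]
      refine Finset.sum_congr rfl fun B _ => ?_
      rw [Finset.mul_sum, Real.exp_sum]
    rw [h1]
    have h2 : ∀ ω, ∑ z, Real.exp (lam * h i ω z)
        ≤ (Fintype.card Z : ℝ) * (if ω ∈ W i then Real.exp (lam ^ 2) else 1) := by
      intro ω
      split_ifs with hω
      · have h3 : ∀ z, Real.exp (lam * h i ω z) ≤ 1 + lam * h i ω z + lam ^ 2 := by
          intro z
          have ha := hb i hi ω z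
          have hx : |lam * h i ω z| ≤ 1 := by
            rw [abs_mul, abs_of_nonneg (by positivity)]
            nlinarith [abs_nonneg (h i ω z)]
          have h4 := Real.abs_exp_sub_one_sub_id_le hx
          have h5 : (lam * h i ω z) ^ 2 ≤ lam ^ 2 := by
            rw [mul_pow]
            have : (h i ω z) ^ 2 ≤ 1 := by
              rw [← sq_abs]; nlinarith [abs_nonneg (h i ω z)]
            nlinarith [sq_nonneg lam]
          have := (abs_le.1 h4).2
          linarith
        calc ∑ z, Real.exp (lam * h i ω z) ≤ ∑ z, (1 + lam * h i ω z + lam ^ 2) :=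
              Finset.sum_le_sum fun z _ => h3 z
          _ = (Fintype.card Z : ℝ) * (1 + lam ^ 2) := by
              rw [Finset.sum_add_distrib, Finset.sum_add_distrib, ← Finset.mul_sum, hs i hi ω]
              simp; ring
          _ ≤ _ := by
              refine mul_le_mul_of_nonneg_left ?_ hM.le
              have := Real.add_one_le_exp (lam ^ 2)
              linarith
      · simp [hW i hi ω hω]
    calc ∏ ω, ∑ z, Real.exp (lam * h i ω z)
        ≤ ∏ ω, ((Fintype.card Z : ℝ) * (if ω ∈ W i then Real.exp (lam ^ 2) else 1)) :=
          Finset.prod_le_prod (fun ω _ => Finset.sum_nonneg fun z _ => (Real.exp_pos _).le)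
            fun ω _ => h2 ω
      _ = _ := by
          rw [Finset.prod_mul_distrib, Finset.prod_const, Finset.card_univ,
            Finset.prod_ite_mem, Finset.univ_inter, Finset.prod_const, ← Real.exp_nat_mul,
            hD i hi, mul_comm D]
  have tot : (Fintype.card Z : ℝ) ^ Fintype.card Ω ≤
      ∑ B : Ω → Z, ∑ i ∈ J, Real.exp (lam * ∑ ω, h i ω (B ω)) * Real.exp (-(lam * (ε * D))) := by
    have : (Fintype.card Z : ℝ) ^ Fintype.card Ω = ∑ B : Ω → Z, (1 : ℝ) := by
      simp
    rw [this]
    refine Finset.sum_le_sum fun B _ => ?_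
    obtain ⟨i, hi, hlt⟩ := hcon B
    have h1 : 1 ≤ Real.exp (lam * ∑ ω, h i ω (B ω)) * Real.exp (-(lam * (ε * D))) := by
      rw [← Real.exp_add]
      apply Real.one_le_exp
      have : lam * (ε * D) ≤ lam * ∑ ω, h i ω (B ω) :=
        mul_le_mul_of_nonneg_left hlt.le (by positivity)
      linarith
    exact h1.trans (Finset.single_le_sum
      (f := fun i => Real.exp (lam * ∑ ω, h i ω (B ω)) * Real.exp (-(lam * (ε * D))))
      (fun i _ => by positivity) hi)
  rw [Finset.sum_comm] at tot
  have fin : ∑ i ∈ J, ∑ B : Ω → Z,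
      Real.exp (lam * ∑ ω, h i ω (B ω)) * Real.exp (-(lam * (ε * D)))
      ≤ (Fintype.card Z : ℝ) ^ Fintype.card Ω * (J.card * Real.exp (-(ε ^ 2 * D / 4))) := by
    calc _ ≤ ∑ i ∈ J, (Fintype.card Z : ℝ) ^ Fintype.card Ω * Real.exp (-(ε ^ 2 * D / 4)) := by
          refine Finset.sum_le_sum fun i hi => ?_
          rw [← Finset.sum_mul]
          calc _ ≤ (Fintype.card Z : ℝ) ^ Fintype.card Ω * Real.exp (lam ^ 2 * D)
                * Real.exp (-(lam * (ε * D))) :=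
                mul_le_mul_of_nonneg_right (key i hi) (Real.exp_pos _).le
            _ = _ := by
                rw [mul_assoc, ← Real.exp_add]
                congr 2
                rw [hlam]; ring
      _ = _ := by rw [Finset.sum_const, nsmul_eq_mul]; ring
  have hp : (0 : ℝ) < (Fintype.card Z : ℝ) ^ Fintype.card Ω := by positivity
  nlinarith [tot.trans fin]

/-- Bounded distributions are dominated by flat ones for linear functionals. -/
lemma exists_flat {A : Type*} [Fintype A] [DecidableEq A] (p g : A → ℝ) (K : ℕ) (hK : 0 < K)
    (hp : IsProb p) (hb : ∀ a, p a ≤ (K : ℝ)⁻¹) :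
    ∃ S : Finset A, S.card = K ∧ ∑ a, p a * g a ≤ (K : ℝ)⁻¹ * ∑ a ∈ S, g a := by
  have hK' : (0 : ℝ) < K := by exact_mod_cast hK
  have hN : K ≤ (Finset.univ : Finset A).card := by
    have h1 : (1 : ℝ) ≤ ∑ a : A, (K : ℝ)⁻¹ := hp.2 ▸ Finset.sum_le_sum fun a _ => hb a
    rw [Finset.sum_const, nsmul_eq_mul, ← div_eq_mul_inv, le_div_iff₀ hK', one_mul] at h1
    exact_mod_cast h1
  obtain ⟨S, hS, hmax⟩ := Finset.exists_max_image (Finset.powersetCard K (Finset.univ : Finset A))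
    (fun S => ∑ a ∈ S, g a) (Finset.powersetCard_nonempty.2 hN)
  have hSc : S.card = K := (Finset.mem_powersetCard.1 hS).2
  have hSne : S.Nonempty := by rw [← Finset.card_pos]; omega
  obtain ⟨m, hm, hmin⟩ := Finset.exists_min_image S g hSne
  have hout : ∀ b, b ∉ S → g b ≤ g m := by
    intro b hbS
    have hb' : b ∉ S.erase m := fun h => hbS (Finset.mem_of_mem_erase h)
    have := hmax (insert b (S.erase m)) (by
      rw [Finset.mem_powersetCard]
      refine ⟨Finset.subset_univ _, ?_⟩
      rw [Finset.card_insert_of_notMem hb', Finset.card_erase_of_mem hm]; omega)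
    simp only [Finset.sum_insert hb'] at this
    have h2 := Finset.add_sum_erase S g hm
    linarith
  refine ⟨S, hSc, ?_⟩
  have h1 : ∑ a, p a * g a = ∑ a, p a * (g a - g m) + g m := by
    simp only [mul_sub, Finset.sum_sub_distrib]
    rw [← Finset.sum_mul, hp.2]; ring
  have h2 : ∑ a, p a * (g a - g m) ≤ ∑ a ∈ S, (K : ℝ)⁻¹ * (g a - g m) := by
    rw [← Finset.sum_filter_add_sum_filter_not Finset.univ (· ∈ S)]
    have h3 : ∑ a with a ∉ S, p a * (g a - g m) ≤ 0 := by
      refine Finset.sum_nonpos fun a ha => ?_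
      have := hout a (Finset.mem_filter.1 ha).2
      nlinarith [hp.1 a]
    have h4 : ∑ a with a ∈ S, p a * (g a - g m) ≤ ∑ a ∈ S, (K : ℝ)⁻¹ * (g a - g m) := by
      rw [Finset.filter_mem_eq_inter, Finset.univ_inter]
      refine Finset.sum_le_sum fun a ha => ?_
      exact mul_le_mul_of_nonneg_right (hb a) (by linarith [hmin a ha])
    linarith
  have h5 : ∑ a ∈ S, (K : ℝ)⁻¹ * (g a - g m) = (K : ℝ)⁻¹ * ∑ a ∈ S, g a - g m := by
    rw [← Finset.mul_sum, Finset.sum_sub_distrib, Finset.sum_const, hSc, nsmul_eq_mul, mul_sub,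
      inv_mul_cancel_left₀ hK'.ne']
  linarith

/-- The centred indicator test. -/
noncomputable def ctest {Z : Type*} [Fintype Z] [DecidableEq Z] (T : Finset Z) (z : Z) : ℝ :=
  (if z ∈ T then 1 else 0) - (T.card : ℝ) / Fintype.card Z

lemma ctest_sum {Z : Type*} [Fintype Z] [DecidableEq Z] [Nonempty Z] (T : Finset Z) :
    ∑ z, ctest T z = 0 := by
  have hM : (Fintype.card Z : ℝ) ≠ 0 := by exact_mod_cast Fintype.card_ne_zero
  simp only [ctest, Finset.sum_sub_distrib, Finset.sum_const, nsmul_eq_mul, Finset.card_univ]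
  simp
  field_simp
  simp

lemma ctest_abs {Z : Type*} [Fintype Z] [DecidableEq Z] [Nonempty Z] (T : Finset Z) (z : Z) :
    |ctest T z| ≤ 1 := by
  have hM : (0 : ℝ) < Fintype.card Z := by exact_mod_cast Fintype.card_pos
  have h1 : (T.card : ℝ) / Fintype.card Z ≤ 1 := by
    rw [div_le_one hM]; exact_mod_cast Finset.card_le_univ T
  have h0 : 0 ≤ (T.card : ℝ) / Fintype.card Z := by positivity
  unfold ctest
  rw [abs_le]
  split_ifs <;> constructor <;> linarith

lemma ctest_compl {Z : Type*} [Fintype Z] [DecidableEq Z] [Nonempty Z] (T : Finset Z) (z : Z) :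
    ctest Tᶜ z = - ctest T z := by
  have hM : (Fintype.card Z : ℝ) ≠ 0 := by exact_mod_cast Fintype.card_ne_zero
  unfold ctest
  rw [Finset.card_compl, Nat.cast_sub (Finset.card_le_univ T), sub_div, div_self hM]
  by_cases h : z ∈ T <;> simp [h]

/-- Existence of a two-source extractor for flat sources, strong in both sources. -/
lemma exists_flat_ext {A Z : Type*} [Fintype A] [DecidableEq A] [Fintype Z] [DecidableEq Z]
    [Nonempty Z] (K : ℕ) (ε : ℝ) (hε0 : 0 ≤ ε) (hε1 : ε ≤ 1)
    (hc : (2 * ((Fintype.card A : ℝ) ^ K * (Fintype.card A : ℝ) ^ K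
      * (2 ^ Fintype.card Z) ^ K)) * Real.exp (-(ε ^ 2 * (K : ℝ) ^ 2 / 4)) < 1) :
    ∃ B : A → A → Z, ∀ S S' : Finset A, S.card = K → S'.card = K → ∀ T : A → Finset Z,
      (∑ x ∈ S, ∑ y ∈ S', ctest (T y) (B x y) ≤ ε * (K : ℝ) ^ 2) ∧
      (∑ x ∈ S, ∑ y ∈ S', ctest (T y) (B y x) ≤ ε * (K : ℝ) ^ 2) := by
  let P : Finset (Finset A) := Finset.powersetCard K Finset.univ
  let F : Finset A → Finset (A → Finset Z) := fun S' =>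
    Fintype.piFinset fun y => if y ∈ S' then Finset.univ else {∅}
  let J : Finset ((_ : Bool × Finset A × Finset A) × (A → Finset Z)) :=
    (Finset.univ ×ˢ P ×ˢ P).sigma fun i => F i.2.2
  let sw : Bool → A × A → A × A := fun b ω => if b then ω else ω.swap
  have hsw : ∀ b ω, sw b (sw b ω) = ω := by intro b ω; cases b <;> simp [sw]
  let W : ((_ : Bool × Finset A × Finset A) × (A → Finset Z)) → Finset (A × A) := fun i =>
    (i.1.2.1 ×ˢ i.1.2.2).image (sw i.1.1)
  let h : ((_ : Bool × Finset A × Finset A) × (A → Finset Z)) → A × A → Z → ℝ := fun i ω z =>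
    if sw i.1.1 ω ∈ i.1.2.1 ×ˢ i.1.2.2 then ctest (i.2 (sw i.1.1 ω).2) z else 0
  have hJ : ∀ i ∈ J, i.1.2.1.card = K ∧ i.1.2.2.card = K := by
    intro i hi
    simp only [J, P, Finset.mem_sigma, Finset.mem_product, Finset.mem_powersetCard] at hi
    exact ⟨hi.1.2.1.2, hi.1.2.2.2⟩
  have hF : ∀ S' ∈ P, (F S').card = (2 ^ Fintype.card Z) ^ K := by
    intro S' hS'
    simp only [F, Fintype.card_piFinset, apply_ite Finset.card, Finset.card_singleton]
    rw [Finset.prod_ite_mem, Finset.univ_inter, Finset.prod_const,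
      (Finset.mem_powersetCard.1 hS').2]
    simp
  have hJc : (J.card : ℝ) ≤ 2 * ((Fintype.card A : ℝ) ^ K * (Fintype.card A : ℝ) ^ K
      * (2 ^ Fintype.card Z) ^ K) := by
    have h1 : J.card = 2 * (P.card * P.card) * (2 ^ Fintype.card Z) ^ K := by
      simp only [J, Finset.card_sigma]
      rw [Finset.sum_congr rfl (g := fun _ => (2 ^ Fintype.card Z) ^ K)]
      · rw [Finset.sum_const, Finset.card_product, Finset.card_product]; simp
      · intro i hi
        simp only [Finset.mem_product] at hi
        exact hF _ hi.2.2
    have h2 : P.card ≤ Fintype.card A ^ K := by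
      simp only [P, Finset.card_powersetCard, Finset.card_univ]
      exact Nat.choose_le_pow _ _
    rw [h1]
    have h3 : 2 * (P.card * P.card) * (2 ^ Fintype.card Z) ^ K ≤
        2 * (Fintype.card A ^ K * Fintype.card A ^ K * (2 ^ Fintype.card Z) ^ K) := by
      rw [mul_assoc]
      gcongr
    exact_mod_cast h3
  obtain ⟨B, hB⟩ := exists_good_fun J h W ε ((K : ℝ) ^ 2) hε0 hε1
    (by
      intro i _ ω z
      simp only [h]
      split_ifs
      · exact ctest_abs _ _
      · simp)
    (by
      intro i _ ω
      simp only [h]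
      split_ifs
      · exact ctest_sum _
      · simp)
    (by
      intro i _ ω hω z
      simp only [h]
      rw [if_neg]
      intro hmem
      exact hω (Finset.mem_image.2 ⟨_, hmem, hsw _ _⟩))
    (by
      intro i hi
      simp only [W]
      rw [Finset.card_image_of_injective, Finset.card_product, (hJ i hi).1, (hJ i hi).2]
      · push_cast; ring
      · intro a b hab
        rw [← hsw i.1.1 a, hab, hsw])
    (lt_of_le_of_lt (mul_le_mul_of_nonneg_right hJc (Real.exp_pos _).le) hc)
  have main : ∀ b : Bool, ∀ S S' : Finset A, S.card = K → S'.card = K → ∀ T : A → Finset Z,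
      ∑ x ∈ S, ∑ y ∈ S', ctest (T y) (B (sw b (x, y))) ≤ ε * (K : ℝ) ^ 2 := by
    intro b S S' hS hS' T
    let T' : A → Finset Z := fun y => if y ∈ S' then T y else ∅
    have hi := hB ⟨(b, S, S'), T'⟩ (by
      simp only [J, P, F, Finset.mem_sigma, Finset.mem_product, Finset.mem_powersetCard,
        Fintype.mem_piFinset]
      refine ⟨⟨Finset.mem_univ _, ⟨Finset.subset_univ _, hS⟩, ⟨Finset.subset_univ _, hS'⟩⟩, ?_⟩
      intro y
      simp only [T']
      split_ifs <;> simp)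
    refine le_trans (le_of_eq ?_) hi
    have hinv : Function.Involutive (sw b) := hsw b
    rw [← Equiv.sum_comp hinv.toPerm, ← Finset.sum_product']
    simp only [h, Function.Involutive.coe_toPerm, hsw]
    rw [Finset.sum_ite_mem, Finset.univ_inter]
    refine Finset.sum_congr rfl fun ω hω => ?_
    simp only [T', if_pos (Finset.mem_product.1 hω).2]
  refine ⟨fun x y => B (x, y), fun S S' hS hS' T => ⟨?_, ?_⟩⟩
  · simpa [sw] using main true S S' hS hS' T
  · simpa [sw] using main false S S' hS hS' T

/-- From flat sources to general sources, for a fixed test. -/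
lemma flat_to_general {A Z : Type*} [Fintype A] [DecidableEq A] [Fintype Z] [DecidableEq Z]
    (K : ℕ) (hK : 0 < K) (ε : ℝ) (B : A → A → Z) (T : A → Finset Z)
    (hB : ∀ S S' : Finset A, S.card = K → S'.card = K →
      ∑ x ∈ S, ∑ y ∈ S', ctest (T y) (B x y) ≤ ε * (K : ℝ) ^ 2)
    (p q : A → ℝ) (hp : IsProb p) (hq : IsProb q)
    (hpb : ∀ a, p a ≤ (K : ℝ)⁻¹) (hqb : ∀ a, q a ≤ (K : ℝ)⁻¹) :
    ∑ x, p x * ∑ y, q y * ctest (T y) (B x y) ≤ ε := by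
  have hK' : (0 : ℝ) < K := by exact_mod_cast hK
  obtain ⟨S, hS, h1⟩ := exists_flat p (fun x => ∑ y, q y * ctest (T y) (B x y)) K hK hp hpb
  obtain ⟨S', hS', h2⟩ := exists_flat q (fun y => ∑ x ∈ S, ctest (T y) (B x y)) K hK hq hqb
  have h3 : ∑ x ∈ S, ∑ y, q y * ctest (T y) (B x y)
      = ∑ y, q y * ∑ x ∈ S, ctest (T y) (B x y) := by
    rw [Finset.sum_comm]; simp only [Finset.mul_sum]
  have h4 := hB S S' hS hS'
  rw [Finset.sum_comm] at h4
  refine h1.trans ?_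
  rw [h3]
  calc _ ≤ (K : ℝ)⁻¹ * ((K : ℝ)⁻¹ * (ε * (K : ℝ) ^ 2)) := by
        refine mul_le_mul_of_nonneg_left (h2.trans ?_) (by positivity)
        exact mul_le_mul_of_nonneg_left h4 (by positivity)
    _ = ε := by field_simp

/-- Statistical distance bound. -/
lemma statDist_le_of_flat {A Z : Type*} [Fintype A] [DecidableEq A] [Fintype Z] [DecidableEq Z]
    [Nonempty Z] (K : ℕ) (hK : 0 < K) (ε : ℝ) (B : A → A → Z)
    (hB : ∀ S S' : Finset A, S.card = K → S'.card = K → ∀ T : A → Finset Z,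
      ∑ x ∈ S, ∑ y ∈ S', ctest (T y) (B x y) ≤ ε * (K : ℝ) ^ 2)
    (p q : A → ℝ) (hp : IsProb p) (hq : IsProb q)
    (hpb : ∀ a, p a ≤ (K : ℝ)⁻¹) (hqb : ∀ a, q a ≤ (K : ℝ)⁻¹) :
    statDist (fun z : Z × A => ∑ x, if B x z.2 = z.1 then p x * q z.2 else 0)
      (fun z => unif Z z.1 * q z.2) ≤ ε := by
  refine ciSup_le fun T => ?_
  let R : A → Finset Z := fun y => Finset.univ.filter fun z => (z, y) ∈ T
  have hT : ∀ f : Z × A → ℝ, ∑ a ∈ T, f a = ∑ y, ∑ z ∈ R y, f (z, y) := by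
    intro f
    simp only [R, Finset.sum_filter]
    rw [← Fintype.sum_prod_type_right' (f := fun z y => if (z, y) ∈ T then f (z, y) else 0)]
    rw [Finset.sum_ite_mem, Finset.univ_inter]
  have e : ∑ a ∈ T, (∑ x, if B x a.2 = a.1 then p x * q a.2 else 0)
      - ∑ a ∈ T, unif Z a.1 * q a.2 = ∑ x, p x * ∑ y, q y * ctest (R y) (B x y) := by
    rw [hT, hT]
    have e1 : ∀ y, ∑ z ∈ R y, (∑ x, if B x y = z then p x * q y else 0)
        = ∑ x, p x * (q y * if B x y ∈ R y then 1 else 0) := by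
      intro y
      rw [Finset.sum_comm]
      refine Finset.sum_congr rfl fun x _ => ?_
      rw [Finset.sum_ite_eq]
      split_ifs <;> simp
    have e2 : ∀ y, ∑ z ∈ R y, unif Z z * q y
        = ∑ x, p x * (q y * (((R y).card : ℝ) / Fintype.card Z)) := by
      intro y
      rw [← Finset.sum_mul (s := Finset.univ) (f := p), hp.2]
      simp only [unif, Finset.sum_const, nsmul_eq_mul]
      ring
    simp only [e1, e2]
    rw [← Finset.sum_sub_distrib]
    simp only [← Finset.sum_sub_distrib, ← mul_sub]
    rw [Finset.sum_comm]
    simp only [ctest, Finset.mul_sum]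
  rw [e, abs_le]
  constructor
  · have := flat_to_general K hK ε B (fun y => (R y)ᶜ) (fun S S' h h' => hB S S' h h' _)
      p q hp hq hpb hqb
    simp only [ctest_compl, mul_neg, Finset.sum_neg_distrib] at this
    linarith
  · exact flat_to_general K hK ε B R (fun S S' h h' => hB S S' h h' _) p q hp hq hpb hqb

/-- A block source has high min-entropy (from its first block). -/
lemma block_source_bound {n t k : ℕ} (p : (Fin (t + 1) → BitStr n) → ℝ) (hp : IsProb p)
    (hb : IsBlockSourceT p (2 * k : ℝ)) (x : Fin (t + 1) → BitStr n) :
    p x ≤ (((4 ^ k : ℕ) : ℝ))⁻¹ := by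
  have h0 : prefixProb p ((0 : Fin (t + 1)) : ℕ) x = 1 := by
    simp [prefixProb, hp.2]
  have h1 := hb 0 x (by rw [h0]; norm_num)
  rw [h0, mul_one] at h1
  have h2 : p x ≤ prefixProb p (((0 : Fin (t + 1)) : ℕ) + 1) x := by
    unfold prefixProb
    have := Finset.single_le_sum (s := Finset.univ)
      (f := fun x' => if ∀ j : Fin (t + 1), (j : ℕ) < ((0 : Fin (t + 1)) : ℕ) + 1 → x' j = x j
        then p x' else 0)
      (fun x' _ => by split_ifs; exacts [hp.1 _, le_rfl]) (Finset.mem_univ x)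
    simpa using this
  have h3 : (2 : ℝ) ^ (-(2 * k : ℝ)) = (((4 ^ k : ℕ) : ℝ))⁻¹ := by
    rw [Real.rpow_neg (by norm_num), Real.rpow_mul (by norm_num), Real.rpow_natCast]
    norm_num
  exact (h2.trans h1).trans h3.le

lemma count_bound (n k t : ℕ) (hn : n ≤ 2 ^ k) (hk : 80 * t + 400 ≤ k) :
    (2 * (((2 : ℝ) ^ (n * t)) ^ (4 ^ k) * ((2 : ℝ) ^ (n * t)) ^ (4 ^ k)
      * (2 ^ (2 ^ (9 * k / 5))) ^ (4 ^ k)))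
      * Real.exp (-(((2 : ℝ) ^ (-(k : ℝ) ^ (1 / 2 : ℝ))) ^ 2 * ((4 ^ k : ℕ) : ℝ) ^ 2 / 4)) < 1 := by
  set K : ℕ := 4 ^ k with hK
  set M : ℕ := 2 ^ (9 * k / 5) with hM
  have hK1 : (1 : ℝ) ≤ K := by exact_mod_cast Nat.one_le_pow _ _ (by norm_num)
  have e1 : (2 * (((2 : ℝ) ^ (n * t)) ^ K * ((2 : ℝ) ^ (n * t)) ^ K * (2 ^ M) ^ K))
      = 2 ^ (1 + (2 * (n * t) + M) * K) := by
    rw [← pow_mul, ← pow_mul, ← pow_add, ← pow_add, ← pow_succ']; congr 1; ring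
  have e2 : (2 : ℝ) ^ (1 + (2 * (n * t) + M) * K) ≤
      Real.exp (((1 + (2 * (n * t) + M) * K : ℕ) : ℝ)) := by
    rw [← Real.exp_one_pow]
    refine pow_le_pow_left₀ (by norm_num) ?_ _
    have := Real.add_one_le_exp 1
    linarith
  rw [e1]
  refine lt_of_le_of_lt (mul_le_mul_of_nonneg_right e2 (Real.exp_pos _).le) ?_
  rw [← Real.exp_add, Real.exp_lt_one_iff]
  have hkR : (80 * t + 400 : ℝ) ≤ k := by exact_mod_cast hk
  have ht0 : (0 : ℝ) ≤ t := Nat.cast_nonneg t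
  set s : ℝ := (k : ℝ) ^ (1 / 2 : ℝ) with hs
  have hsq : s * s = k := by
    rw [hs, ← Real.sqrt_eq_rpow]; exact Real.mul_self_sqrt (Nat.cast_nonneg k)
  have hs0 : 0 ≤ s := by positivity
  have hs20 : 20 ≤ s := by nlinarith
  have hM' : (M : ℝ) ≤ (2 : ℝ) ^ (1.8 * k : ℝ) := by
    rw [hM]; push_cast
    rw [← Real.rpow_natCast]
    refine Real.rpow_le_rpow_of_exponent_le (by norm_num) ?_
    have : ((9 * k / 5 : ℕ) : ℝ) ≤ ((9 * k : ℕ) : ℝ) / ((5 : ℕ) : ℝ) := Nat.cast_div_le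
    push_cast at this
    linarith
  have hn' : (n : ℝ) ≤ (2 : ℝ) ^ (1.8 * k : ℝ) := by
    calc (n : ℝ) ≤ (2 : ℝ) ^ k := by exact_mod_cast hn
      _ = (2 : ℝ) ^ (k : ℝ) := (Real.rpow_natCast _ _).symm
      _ ≤ _ := Real.rpow_le_rpow_of_exponent_le (by norm_num) (by linarith)
  set Q : ℝ := (2 : ℝ) ^ (1.8 * k : ℝ) with hQ
  have hQ1 : 1 ≤ Q := Real.one_le_rpow (by norm_num) (by linarith)
  have hε : ((2 : ℝ) ^ (-s)) ^ 2 * (K : ℝ) = (2 : ℝ) ^ (2 * k - 2 * s : ℝ) := by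
    have : (K : ℝ) = (2 : ℝ) ^ (2 * k : ℝ) := by
      rw [hK, Real.rpow_mul (by norm_num), Real.rpow_natCast]; norm_num
    rw [this, ← Real.rpow_natCast, ← Real.rpow_mul (by norm_num),
      ← Real.rpow_add (by norm_num)]
    congr 1; push_cast; ring
  have hbig : Q * (8 * t + 40) ≤ (2 : ℝ) ^ (2 * k - 2 * s : ℝ) := by
    have h1 : (1.8 * k + 0.1 * k : ℝ) ≤ 2 * k - 2 * s := by nlinarith
    have h2 : (2 : ℝ) ^ (1.8 * k + 0.1 * k : ℝ) ≤ (2 : ℝ) ^ (2 * k - 2 * s : ℝ) :=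
      Real.rpow_le_rpow_of_exponent_le (by norm_num) h1
    rw [Real.rpow_add (by norm_num)] at h2
    refine le_trans (mul_le_mul_of_nonneg_left ?_ (by positivity)) h2
    have h3 : ((8 * t + 40 : ℕ) : ℝ) ≤ (2 : ℝ) ^ (8 * t + 40) := by
      exact_mod_cast (Nat.lt_two_pow_self).le
    calc (8 * t + 40 : ℝ) = ((8 * t + 40 : ℕ) : ℝ) := by push_cast; ring
      _ ≤ _ := h3
      _ = (2 : ℝ) ^ ((8 * t + 40 : ℕ) : ℝ) := (Real.rpow_natCast _ _).symm
      _ ≤ _ := Real.rpow_le_rpow_of_exponent_le (by norm_num) (by push_cast; linarith)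
  have hfin : 4 * (1 + 2 * (n * t) + M : ℝ) < ((2 : ℝ) ^ (-s)) ^ 2 * (K : ℝ) := by
    rw [hε]
    refine lt_of_lt_of_le ?_ hbig
    nlinarith [mul_le_mul_of_nonneg_right hn' ht0]
  push_cast
  have h6 := mul_lt_mul_of_pos_right hfin (lt_of_lt_of_le one_pos hK1)
  nlinarith

/-- For every constant `η > 0` there are constants `C₀ > 1` and `c > 0`
such that for all `n ≥ C₀` and `k ≥ (1/2)(log₂ n)^{2+η}`, with `t = ⌈7/η⌉ + 1` there is
a function `BExt : ({0,1}ⁿ)ᵗ × ({0,1}ⁿ)ᵗ → {0,1}^m`, `m = ⌊1.8k⌋`, such that for all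
independent `t`-block `(2k,…,2k)` block sources `X` and `Y`,
`|(BExt(X,Y), Y) − (U_m, Y)| ≤ ε` and `|(BExt(X,Y), X) − (U_m, X)| ≤ ε`,
`ε = 2^{−k^c}`. -/
theorem block_source_extractor_main :
    ∀ η : ℝ, 0 < η →
      ∃ C₀ c : ℝ, 1 < C₀ ∧ 0 < c ∧
        ∀ n k : ℕ, C₀ ≤ (n : ℝ) → Real.logb 2 n ^ ((2 : ℝ) + η) / 2 ≤ (k : ℝ) →
          ∃ BExt : (Fin (⌈(7 : ℝ) / η⌉₊ + 1) → BitStr n) →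
              (Fin (⌈(7 : ℝ) / η⌉₊ + 1) → BitStr n) → BitStr (9 * k / 5),
            ∀ pX pY : (Fin (⌈(7 : ℝ) / η⌉₊ + 1) → BitStr n) → ℝ,
              IsProb pX → IsProb pY →
              IsBlockSourceT pX (2 * k : ℝ) → IsBlockSourceT pY (2 * k : ℝ) →
              statDist
                  (fun z : BitStr (9 * k / 5) × (Fin (⌈(7 : ℝ) / η⌉₊ + 1) → BitStr n) =>
                    ∑ x, if BExt x z.2 = z.1 then pX x * pY z.2 else 0)
                  (fun z => unif (BitStr (9 * k / 5)) z.1 * pY z.2)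
                ≤ (2 : ℝ) ^ (-(k : ℝ) ^ c) ∧
              statDist
                  (fun z : BitStr (9 * k / 5) × (Fin (⌈(7 : ℝ) / η⌉₊ + 1) → BitStr n) =>
                    ∑ y, if BExt z.2 y = z.1 then pX z.2 * pY y else 0)
                  (fun z => unif (BitStr (9 * k / 5)) z.1 * pX z.2)
                ≤ (2 : ℝ) ^ (-(k : ℝ) ^ c) := by
  intro η hη
  set t := ⌈(7 : ℝ) / η⌉₊ with ht
  refine ⟨(2 : ℝ) ^ (80 * (t + 1) + 400), 1 / 2, one_lt_pow₀ (by norm_num) (by omega),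
    by norm_num, ?_⟩
  intro n k hn hk
  have hL : ((80 * (t + 1) + 400 : ℕ) : ℝ) ≤ Real.logb 2 n := by
    rw [Real.le_logb_iff_rpow_le (by norm_num) (lt_of_lt_of_le (by positivity) hn),
      Real.rpow_natCast]
    exact hn
  have hL2 : (2 : ℝ) ≤ Real.logb 2 n := by
    refine le_trans ?_ hL
    exact_mod_cast (by omega : 2 ≤ 80 * (t + 1) + 400)
  have hLk : Real.logb 2 n ≤ k := by
    have h1 : Real.logb 2 n ^ (2 : ℝ) ≤ Real.logb 2 n ^ ((2 : ℝ) + η) :=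
      Real.rpow_le_rpow_of_exponent_le (by linarith) (by linarith)
    rw [Real.rpow_two] at h1
    nlinarith
  have hkb : 80 * (t + 1) + 400 ≤ k := by exact_mod_cast hL.trans hLk
  have hn2 : n ≤ 2 ^ k := by
    rw [Real.logb_le_iff_le_rpow (by norm_num) (lt_of_lt_of_le (by positivity) hn),
      Real.rpow_natCast] at hLk
    exact_mod_cast hLk
  have hε0 : (0 : ℝ) ≤ (2 : ℝ) ^ (-(k : ℝ) ^ (1 / 2 : ℝ)) := by positivity
  have hε1 : (2 : ℝ) ^ (-(k : ℝ) ^ (1 / 2 : ℝ)) ≤ 1 :=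
    Real.rpow_le_one_of_one_le_of_nonpos (by norm_num) (by
      have : (0 : ℝ) ≤ (k : ℝ) ^ (1 / 2 : ℝ) := by positivity
      linarith)
  obtain ⟨B, hB⟩ := exists_flat_ext (A := Fin (t + 1) → BitStr n) (Z := BitStr (9 * k / 5))
    (4 ^ k) _ hε0 hε1 (by
      have := count_bound n k (t + 1) hn2 hkb
      simpa [← pow_mul] using this)
  refine ⟨B, fun pX pY hX hY hbX hbY => ⟨?_, ?_⟩⟩
  · exact statDist_le_of_flat (4 ^ k) (by positivity) _ B
      (fun S S' h h' T => (hB S S' h h' T).1) pX pY hX hY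
      (block_source_bound pX hX hbX) (block_source_bound pY hY hbY)
  · have := statDist_le_of_flat (4 ^ k) (by positivity) _ (fun y x => B x y)
      (fun S S' h h' T => (hB S S' h h' T).2) pY pX hY hX
      (block_source_bound pY hY hbY) (block_source_bound pX hX hbX)
    simpa only [mul_comm (pX _) (pY _)] using this
end

section
/- There is an absolute constant c > 0 such that the following holds. Let ℓ, t, h ∈ ℕ with h ≥ 2, n, n_q, k, k_q ∈ ℕ, and ε > 0. Let Ext_q : {0,1}^{n_q} × {0,1}^ℓ → {0,1}^ℓ and Ext_w : {0,1}^n × {0,1}^ℓ → {0,1}^ℓ be strong (10ℓ, ε) seeded extractors. Let Y = (Q, S₁) where Q is an (n_q, k_q)-source and S₁ is uniform on {0,1}^ℓ (possibly correlated with Q), and let Y₂ = (Q₂, S_{2,1}), …, Y_h = (Q_h, S_{h,1}) be arbitrary random variables with the same range as Y, arbitrarily correlated with Y. Let X be an (n, k)-source independent of (Y, Y₂, …, Y_h), and assume k > htℓ + 10ℓ + 2log₂(1/ε) and k_q > htℓ + 10ℓ + 2log₂(1/ε). Let (R₁,…,R_t) = laExt(X, Y) and (R_{i,1},…,R_{i,t})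 = laExt(X, Y_i) for i = 2,…,h. Then for every 0 ≤ j ≤ t − 1, the statistical distance between (Y, Y₂,…,Y_h, {R_{i,1},…,R_{i,j} : i = 2,…,h}, R_{j+1}) and (Y, Y₂,…,Y_h, {R_{i,1},…,R_{i,j} : i = 2,…,h}, U_ℓ) is at most c·t·ε. -/
open Finset

/-- `Ext` is a strong `(k, ε)` seeded extractor. -/
def IsStrongSeededExtractor {n d m : ℕ} (Ext : BitStr n → BitStr d → BitStr m)
    (k ε : ℝ) : Prop :=
  ∀ p : BitStr n → ℝ, IsProb p → IsKSource p k →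
    statDist
      (fun z : BitStr m × BitStr d =>
        (∑ x : BitStr n, if Ext x z.2 = z.1 then p x else 0) * unif (BitStr d) z.2)
      (fun z => unif (BitStr m) z.1 * unif (BitStr d) z.2) ≤ ε

/-- Alternating extraction: `laS … j` is `S_{j+1}`, i.e. `S₁ = s₁`,
`S_{j+1} = Ext_q(Q, R_j)` where `R_j = Ext_w(X, S_j)`. -/
def laS {n nq ℓ : ℕ} (Extq : BitStr nq → BitStr ℓ → BitStr ℓ)
    (Extw : BitStr n → BitStr ℓ → BitStr ℓ)
    (x : BitStr n) (q : BitStr nq) (s₁ : BitStr ℓ) : ℕ → BitStr ℓ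
  | 0 => s₁
  | j + 1 => Extq q (Extw x (laS Extq Extw x q s₁ j))

/-- `laR … j` is `R_{j+1} = Ext_w(X, S_{j+1})`; the look-ahead extractor is
`laExt(X, (Q, S₁)) = (R₁, …, R_t) = (laR … 0, …, laR … (t−1))`. -/
def laR {n nq ℓ : ℕ} (Extq : BitStr nq → BitStr ℓ → BitStr ℓ)
    (Extw : BitStr n → BitStr ℓ → BitStr ℓ)
    (x : BitStr n) (q : BitStr nq) (s₁ : BitStr ℓ) (j : ℕ) : BitStr ℓ :=
  Extw x (laS Extq Extw x q s₁ j)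


section Helpers

/-- Mass of the fiber of `g` over `r`, under the weight `u`. -/
noncomputable def fibm {A M : Type} [Fintype A] [DecidableEq M] (g : A → M) (u : A → ℝ) (r : M) : ℝ :=
  ∑ a, if g a = r then u a else 0

/-- Unnormalised L1 deviation of `g` from uniform under the weight `u`. -/
noncomputable def devm {A M : Type} [Fintype A] [Fintype M] [DecidableEq M]
    (g : A → M) (u : A → ℝ) : ℝ :=
  ∑ r, |fibm g u r - unif M r * ∑ a, u a|

theorem sum_unif_one {M : Type} [Fintype M] [Nonempty M] : ∑ r, unif M r = 1 := by
  simp [unif]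

theorem unif_nonneg {M : Type} [Fintype M] (r : M) : 0 ≤ unif M r := by
  simp [unif]

theorem sum_fibm_mul {A M : Type} [Fintype A] [Fintype M] [DecidableEq M]
    (g : A → M) (u : A → ℝ) (φ : M → ℝ) : ∑ r, fibm g u r * φ r = ∑ a, u a * φ (g a) := by
  unfold fibm
  simp_rw [Finset.sum_mul]
  rw [Finset.sum_comm]
  refine Finset.sum_congr rfl fun a _ => ?_
  simp [ite_mul]

theorem sum_fibm {A M : Type} [Fintype A] [Fintype M] [DecidableEq M]
    (g : A → M) (u : A → ℝ) : ∑ r, fibm g u r = ∑ a, u a := by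
  simpa using sum_fibm_mul g u (fun _ => 1)

theorem fibm_nonneg {A M : Type} [Fintype A] [DecidableEq M]
    (g : A → M) (u : A → ℝ) (hu : ∀ a, 0 ≤ u a) (r : M) : 0 ≤ fibm g u r := by
  unfold fibm
  refine Finset.sum_nonneg fun a _ => ?_
  split_ifs
  · exact hu a
  · exact le_rfl

theorem devm_nonneg {A M : Type} [Fintype A] [Fintype M] [DecidableEq M]
    (g : A → M) (u : A → ℝ) : 0 ≤ devm g u :=
  Finset.sum_nonneg fun _ _ => abs_nonneg _

theorem devm_le {A M : Type} [Fintype A] [Fintype M] [Nonempty M] [DecidableEq M]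
    (g : A → M) (u : A → ℝ) (hu : ∀ a, 0 ≤ u a) : devm g u ≤ 2 * ∑ a, u a := by
  have hU : 0 ≤ ∑ a, u a := Finset.sum_nonneg fun a _ => hu a
  calc devm g u ≤ ∑ r, (fibm g u r + unif M r * ∑ a, u a) := by
        refine Finset.sum_le_sum fun r _ => ?_
        have h1 := fibm_nonneg g u hu r
        have h2 := mul_nonneg (unif_nonneg r) hU
        rw [abs_le]; constructor <;> linarith
    _ = 2 * ∑ a, u a := by
        rw [Finset.sum_add_distrib, sum_fibm, ← Finset.sum_mul, sum_unif_one]; ring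

theorem statDist_le_l1 {α : Type*} [Fintype α] (p q : α → ℝ) :
    statDist p q ≤ ∑ a, |p a - q a| := by
  refine ciSup_le fun T => ?_
  rw [← Finset.sum_sub_distrib]
  exact (Finset.abs_sum_le_sum_abs _ _).trans
    (Finset.sum_le_sum_of_subset_of_nonneg (Finset.subset_univ _) fun _ _ _ => abs_nonneg _)

theorem l1_le_statDist {α : Type*} [Fintype α] (p q : α → ℝ) :
    ∑ a, |p a - q a| ≤ 2 * statDist p q := by
  classical
  have key : ∀ T : Finset α, |∑ a ∈ T, p a - ∑ a ∈ T, q a| ≤ statDist p q := fun T =>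
    le_ciSup (f := fun T : Finset α => |∑ a ∈ T, p a - ∑ a ∈ T, q a|)
      (Set.finite_range _).bddAbove T
  have h1 := key (Finset.univ.filter fun a => 0 ≤ p a - q a)
  have h2 := key (Finset.univ.filter fun a => ¬ 0 ≤ p a - q a)
  rw [← Finset.sum_sub_distrib] at h1 h2
  rw [← Finset.sum_filter_add_sum_filter_not Finset.univ (fun a => 0 ≤ p a - q a)]
  have e1 : ∑ a ∈ Finset.univ.filter (fun a => 0 ≤ p a - q a), |p a - q a|
      = ∑ a ∈ Finset.univ.filter (fun a => 0 ≤ p a - q a), (p a - q a) :=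
    Finset.sum_congr rfl fun a ha => abs_of_nonneg (Finset.mem_filter.1 ha).2
  have e2 : ∑ a ∈ Finset.univ.filter (fun a => ¬ 0 ≤ p a - q a), |p a - q a|
      = - ∑ a ∈ Finset.univ.filter (fun a => ¬ 0 ≤ p a - q a), (p a - q a) := by
    rw [← Finset.sum_neg_distrib]
    exact Finset.sum_congr rfl fun a ha =>
      abs_of_neg (not_le.1 (Finset.mem_filter.1 ha).2)
  rw [e1, e2]
  have := le_abs_self (∑ a ∈ Finset.univ.filter (fun a => 0 ≤ p a - q a), (p a - q a))
  have := neg_le_abs (∑ a ∈ Finset.univ.filter (fun a => ¬ 0 ≤ p a - q a), (p a - q a))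
  linarith

theorem ext_l1 {n ℓ : ℕ} (Ext : BitStr n → BitStr ℓ → BitStr ℓ) (K ε : ℝ)
    (hE : IsStrongSeededExtractor Ext K ε) (p : BitStr n → ℝ) (hp : IsProb p)
    (hk : IsKSource p K) :
    ∑ s, unif (BitStr ℓ) s * devm (fun x => Ext x s) p ≤ 2 * ε := by
  have h := (l1_le_statDist _ _).trans (mul_le_mul_of_nonneg_left (hE p hp hk) (by norm_num))
  refine le_trans (le_of_eq ?_) h
  rw [Fintype.sum_prod_type, Finset.sum_comm]
  refine Finset.sum_congr rfl fun s _ => ?_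
  rw [devm, Finset.mul_sum]
  refine Finset.sum_congr rfl fun r _ => ?_
  rw [← sub_mul, abs_mul, abs_of_nonneg (unif_nonneg s), hp.2, mul_one, mul_comm]
  rfl

theorem ext_unnorm {A : Type} [Fintype A] {n ℓ : ℕ} (Ext : BitStr n → BitStr ℓ → BitStr ℓ)
    (K ε k : ℝ) (hε : 0 ≤ ε)
    (hE : IsStrongSeededExtractor Ext K ε) (π : A → BitStr n) (u : A → ℝ) (hu : ∀ a, 0 ≤ u a)
    (hk : ∀ q, fibm π u q ≤ (2:ℝ) ^ (-k)) :
    ∑ s, unif (BitStr ℓ) s * devm (fun a => Ext (π a) s) u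
      ≤ 2 * ε * ∑ a, u a + 2 * (2:ℝ) ^ (K - k) := by
  have hU : 0 ≤ ∑ a, u a := Finset.sum_nonneg fun a _ => hu a
  have hpos : (0:ℝ) < (2:ℝ) ^ (K - k) := by positivity
  by_cases hc : ∑ a, u a ≤ (2:ℝ) ^ (K - k)
  · have : ∑ s, unif (BitStr ℓ) s * devm (fun a => Ext (π a) s) u
        ≤ ∑ s, unif (BitStr ℓ) s * (2 * ∑ a, u a) :=
      Finset.sum_le_sum fun s _ => mul_le_mul_of_nonneg_left (devm_le _ u hu) (unif_nonneg s)
    rw [← Finset.sum_mul, sum_unif_one] at this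
    have := mul_nonneg hε hU
    linarith
  · push Not at hc
    have hUp : 0 < ∑ a, u a := hpos.trans hc
    set W := ∑ a, u a with hW
    have h := ext_l1 Ext K ε hE (fun q => fibm π u q / W)
      ⟨fun q => div_nonneg (fibm_nonneg π u hu q) hU, by
        rw [← Finset.sum_div, sum_fibm, div_self hUp.ne']⟩
      (fun q => by
        rw [div_le_iff₀ hUp]
        refine (hk q).trans ?_
        calc (2:ℝ) ^ (-k) = 2 ^ (-K) * 2 ^ (K - k) := by
              rw [← Real.rpow_add (by norm_num)]; congr 1; ring
          _ ≤ _ := mul_le_mul_of_nonneg_left hc.le (by positivity))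
    have e : ∀ s, devm (fun a => Ext (π a) s) u
        = W * devm (fun x => Ext x s) (fun q => fibm π u q / W) := by
      intro s
      rw [devm, devm, Finset.mul_sum]
      refine Finset.sum_congr rfl fun r _ => ?_
      rw [← abs_of_pos hUp, ← abs_mul, abs_of_pos hUp]
      congr 1
      rw [← Finset.sum_div, sum_fibm, ← hW, div_self hUp.ne', mul_sub, mul_one]
      congr 1
      · have := sum_fibm_mul π u (fun q => if Ext q s = r then (1:ℝ) else 0)
        unfold fibm at this ⊢
        rw [Finset.mul_sum]
        simp only [mul_ite, mul_one, mul_zero] at this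
        rw [← this]
        refine Finset.sum_congr rfl fun q _ => ?_
        split_ifs
        · field_simp
        · simp
      · ring
    have h2 := mul_le_mul_of_nonneg_left h hU
    rw [Finset.mul_sum] at h2
    calc _ = ∑ s, W * (unif (BitStr ℓ) s * devm (fun x => Ext x s) (fun q => fibm π u q / W)) := by
          refine Finset.sum_congr rfl fun s _ => ?_
          rw [e]; ring
      _ ≤ _ := h2
      _ ≤ _ := by linarith

/-- One step of the change of seed distribution. -/
theorem seed_swap {B M : Type} [Fintype B] [Fintype M] [Nonempty M] [DecidableEq M]
    (g : B → M) (v : B → ℝ) (D : M → ℝ) (W : ℝ)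
    (hD0 : ∀ m, 0 ≤ D m) (hD : ∀ m, D m ≤ 2 * W) :
    ∑ m, fibm g v m * D m ≤ W * devm g v + (∑ b, v b) * ∑ m, unif M m * D m := by
  have h0 : ∑ m, (fibm g v m - unif M m * ∑ b, v b) = 0 := by
    rw [Finset.sum_sub_distrib, sum_fibm, ← Finset.sum_mul, sum_unif_one]; ring
  have h1 : ∑ m, (fibm g v m - unif M m * ∑ b, v b) * (D m - W) ≤ W * devm g v := by
    rw [devm, Finset.mul_sum]
    refine Finset.sum_le_sum fun m _ => ?_
    refine (le_abs_self _).trans ?_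
    rw [abs_mul, mul_comm W]
    refine mul_le_mul_of_nonneg_left ?_ (abs_nonneg _)
    rw [abs_le]; constructor <;> linarith [hD0 m, hD m]
  have h2 : ∑ m, (fibm g v m - unif M m * ∑ b, v b) * (D m - W)
      = ∑ m, fibm g v m * D m - (∑ b, v b) * ∑ m, unif M m * D m
        - W * ∑ m, (fibm g v m - unif M m * ∑ b, v b) := by
    rw [Finset.mul_sum, Finset.mul_sum, ← Finset.sum_sub_distrib, ← Finset.sum_sub_distrib]
    exact Finset.sum_congr rfl fun m _ => by ring
  rw [h0] at h2
  linarith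

/-- A protocol state: transcripts `T`, with the joint law being a product given the transcript. -/
structure PState {A B T : Type} [Fintype A] [Fintype B] [Fintype T] [DecidableEq T]
    (pA : A → ℝ) (pB : B → ℝ) (u : T → A → ℝ) (v : T → B → ℝ) (tr : A → B → T)
    (NA NB : ℝ) : Prop where
  u0 : ∀ τ a, 0 ≤ u τ a
  v0 : ∀ τ b, 0 ≤ v τ b
  uA : ∀ τ a, u τ a ≤ pA a
  vB : ∀ τ b, v τ b ≤ pB b
  joint : ∀ τ a b, u τ a * v τ b = if tr a b = τ then pA a * pB b else 0
  nA : ∑ τ, ∑ a, u τ a ≤ NA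
  nB : ∑ τ, ∑ b, v τ b ≤ NB

theorem PState.swap {A B T : Type} [Fintype A] [Fintype B] [Fintype T] [DecidableEq T]
    {pA : A → ℝ} {pB : B → ℝ} {u : T → A → ℝ} {v : T → B → ℝ} {tr : A → B → T}
    {NA NB : ℝ} (h : PState pA pB u v tr NA NB) :
    PState pB pA v u (fun b a => tr a b) NB NA :=
  ⟨h.v0, h.u0, h.vB, h.uA, fun τ b a => by rw [mul_comm, h.joint, mul_comm (pB b)], h.nB, h.nA⟩

theorem PState.total {A B T : Type} [Fintype A] [Fintype B] [Fintype T] [DecidableEq T]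
    {pA : A → ℝ} {pB : B → ℝ} {u : T → A → ℝ} {v : T → B → ℝ} {tr : A → B → T}
    {NA NB : ℝ} (h : PState pA pB u v tr NA NB) (hA : ∑ a, pA a = 1) (hB : ∑ b, pB b = 1) :
    ∑ τ, (∑ a, u τ a) * ∑ b, v τ b = 1 := by
  calc ∑ τ, (∑ a, u τ a) * ∑ b, v τ b = ∑ τ, ∑ a, ∑ b, u τ a * v τ b := by
        simp_rw [Finset.sum_mul_sum]
    _ = ∑ a, ∑ b, ∑ τ, u τ a * v τ b := by
        rw [Finset.sum_comm]
        exact Finset.sum_congr rfl fun a _ => Finset.sum_comm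
    _ = ∑ a, ∑ b, pA a * pB b := by
        simp [h.joint]
    _ = 1 := by rw [← Finset.sum_mul_sum, hA, hB, one_mul]

/-- `B` sends the message `g`. -/
theorem PState.extend {A B T V : Type} [Fintype A] [Fintype B] [Fintype T] [DecidableEq T]
    [Fintype V] [DecidableEq V]
    {pA : A → ℝ} {pB : B → ℝ} {u : T → A → ℝ} {v : T → B → ℝ} {tr : A → B → T}
    {NA NB : ℝ} (h : PState pA pB u v tr NA NB) (g : T → B → V) :
    PState (T := T × V) pA pB (fun τ a => u τ.1 a)
      (fun τ b => if g τ.1 b = τ.2 then v τ.1 b else 0)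
      (fun a b => (tr a b, g (tr a b) b)) (NA * Fintype.card V) NB where
  u0 τ a := h.u0 _ _
  v0 τ b := by
    split_ifs
    · exact h.v0 _ _
    · exact le_rfl
  uA τ a := h.uA _ _
  vB τ b := by
    split_ifs
    · exact h.vB _ _
    · exact (h.v0 τ.1 b).trans (h.vB _ _)
  joint := by
    rintro ⟨τ, s⟩ a b
    have := h.joint τ a b
    by_cases h1 : tr a b = τ
    · subst h1
      by_cases h2 : g (tr a b) b = s
      · simpa [h2] using this
      · simp [h2]
    · simp only [h1, if_false] at this
      simp only [Prod.mk.injEq, h1, false_and, if_false, mul_ite, mul_zero, this, ite_self]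
  nA := by
    rw [Fintype.sum_prod_type]
    simp only [Finset.sum_const, Finset.card_univ, nsmul_eq_mul]
    rw [← Finset.mul_sum, mul_comm]
    exact mul_le_mul_of_nonneg_right h.nA (by positivity)
  nB := by
    rw [Fintype.sum_prod_type]
    refine le_trans (le_of_eq ?_) h.nB
    refine Finset.sum_congr rfl fun τ _ => ?_
    exact sum_fibm (g τ) (v τ)

theorem PState.step {A B T I : Type} [Fintype A] [Fintype B] [Fintype T] [DecidableEq T]
    [Fintype I] [DecidableEq I] {n ℓ : ℕ}
    {pA : A → ℝ} {pB : B → ℝ} {u : T → A → ℝ} {v : T → B → ℝ} {tr : A → B → T}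
    {NA NB : ℝ} (h : PState pA pB u v tr NA NB) (hA : ∑ a, pA a = 1) (hB : ∑ b, pB b = 1)
    (g : T → B → I → BitStr ℓ) (i : I)
    (Ext : BitStr n → BitStr ℓ → BitStr ℓ) (K ε k : ℝ) (hε : 0 ≤ ε)
    (hE : IsStrongSeededExtractor Ext K ε) (π : A → BitStr n)
    (hk : ∀ q, fibm π pA q ≤ (2:ℝ) ^ (-k))
    (hN : (2:ℝ) ^ (K - k) * NB ≤ ε) :
    ∑ τ : T × (I → BitStr ℓ), (∑ b, if g τ.1 b = τ.2 then v τ.1 b else 0)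
        * devm (fun a => Ext (π a) (τ.2 i)) (u τ.1)
      ≤ ∑ τ, (∑ a, u τ a) * devm (fun b => g τ b i) (v τ) + 4 * ε := by
  have e1 : ∀ τ, ∑ s : I → BitStr ℓ, (∑ b, if g τ b = s then v τ b else 0)
        * devm (fun a => Ext (π a) (s i)) (u τ)
      ≤ (∑ a, u τ a) * devm (fun b => g τ b i) (v τ)
        + (2 * ε * ((∑ a, u τ a) * ∑ b, v τ b) + 2 * (2:ℝ) ^ (K - k) * ∑ b, v τ b) := by
    intro τ
    have a1 := sum_fibm_mul (g τ) (v τ) (fun s => devm (fun a => Ext (π a) (s i)) (u τ))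
    have a2 := sum_fibm_mul (fun b => g τ b i) (v τ)
      (fun s => devm (fun a => Ext (π a) s) (u τ))
    have a3 := seed_swap (fun b => g τ b i) (v τ)
      (fun s => devm (fun a => Ext (π a) s) (u τ)) (∑ a, u τ a)
      (fun m => devm_nonneg _ _) (fun m => devm_le _ _ (h.u0 τ))
    have a4 := ext_unnorm Ext K ε k hε hE π (u τ) (h.u0 τ) (fun q => by
      refine le_trans ?_ (hk q)
      refine Finset.sum_le_sum fun a _ => ?_
      split_ifs
      · exact h.uA τ a
      · exact le_rfl)
    have a5 := mul_le_mul_of_nonneg_left a4 (Finset.sum_nonneg (s := Finset.univ) fun b _ => h.v0 τ b)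
    unfold fibm at a1
    rw [a1, ← a2]
    linarith
  rw [Fintype.sum_prod_type]
  refine (Finset.sum_le_sum fun τ _ => e1 τ).trans ?_
  rw [Finset.sum_add_distrib, Finset.sum_add_distrib, ← Finset.mul_sum, ← Finset.mul_sum,
    h.total hA hB]
  have : (2:ℝ) ^ (K - k) * ∑ τ, ∑ b, v τ b ≤ (2:ℝ) ^ (K - k) * NB :=
    mul_le_mul_of_nonneg_left h.nB (by positivity)
  linarith

theorem PState.final {A B T H M : Type} [Fintype A] [Fintype B] [Fintype T] [DecidableEq T]
    [Fintype H] [DecidableEq H] [Fintype M] [DecidableEq M]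
    {pA : A → ℝ} {pB : B → ℝ} {u : T → A → ℝ} {v : T → B → ℝ} {tr : A → B → T}
    {NA NB : ℝ} (h : PState pA pB u v tr NA NB) (f : T → A → M) (hist : T → H) :
    ∑ w : B × H × M, |(∑ a, if hist (tr a w.1) = w.2.1 ∧ f (tr a w.1) a = w.2.2
          then pA a * pB w.1 else 0)
        - (∑ a, if hist (tr a w.1) = w.2.1 then pA a * pB w.1 else 0) * unif M w.2.2|
      ≤ ∑ τ, (∑ b, v τ b) * devm (f τ) (u τ) := by
  have e1 : ∀ (b : B) (ρ : H) (r : M),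
      (∑ a, if hist (tr a b) = ρ ∧ f (tr a b) a = r then pA a * pB b else 0)
      = ∑ τ, if hist τ = ρ then v τ b * fibm (f τ) (u τ) r else 0 := by
    intro b ρ r
    have : ∀ a, (if hist (tr a b) = ρ ∧ f (tr a b) a = r then pA a * pB b else 0)
        = ∑ τ, if hist τ = ρ ∧ f τ a = r then u τ a * v τ b else 0 := by
      intro a
      rw [Finset.sum_eq_single (tr a b)]
      · rw [h.joint, if_pos rfl]
      · intro τ _ hτ
        rw [h.joint, if_neg (Ne.symm hτ), ite_self]
      · simp
    simp_rw [this]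
    rw [Finset.sum_comm]
    refine Finset.sum_congr rfl fun τ _ => ?_
    by_cases hh : hist τ = ρ
    · simp only [hh, true_and, if_true, fibm, Finset.mul_sum]
      refine Finset.sum_congr rfl fun a _ => ?_
      split_ifs
      · ring
      · ring
    · simp [hh]
  have e2 : ∀ (b : B) (ρ : H),
      (∑ a, if hist (tr a b) = ρ then pA a * pB b else 0)
      = ∑ τ, if hist τ = ρ then v τ b * ∑ a, u τ a else 0 := by
    intro b ρ
    have : ∀ a, (if hist (tr a b) = ρ then pA a * pB b else 0)
        = ∑ τ, if hist τ = ρ then u τ a * v τ b else 0 := by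
      intro a
      rw [Finset.sum_eq_single (tr a b)]
      · rw [h.joint, if_pos rfl]
      · intro τ _ hτ
        rw [h.joint, if_neg (Ne.symm hτ), ite_self]
      · simp
    simp_rw [this]
    rw [Finset.sum_comm]
    refine Finset.sum_congr rfl fun τ _ => ?_
    by_cases hh : hist τ = ρ
    · simp only [hh, if_true, Finset.mul_sum]
      exact Finset.sum_congr rfl fun a _ => mul_comm _ _
    · simp [hh]
  have e3 : ∀ w : B × H × M, |(∑ a, if hist (tr a w.1) = w.2.1 ∧ f (tr a w.1) a = w.2.2
          then pA a * pB w.1 else 0)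
        - (∑ a, if hist (tr a w.1) = w.2.1 then pA a * pB w.1 else 0) * unif M w.2.2|
      ≤ ∑ τ, if hist τ = w.2.1 then
          v τ w.1 * |fibm (f τ) (u τ) w.2.2 - unif M w.2.2 * ∑ a, u τ a| else 0 := by
    rintro ⟨b, ρ, r⟩
    dsimp only
    rw [e1, e2, Finset.sum_mul, ← Finset.sum_sub_distrib]
    refine (Finset.abs_sum_le_sum_abs _ _).trans (Finset.sum_le_sum fun τ _ => ?_)
    split_ifs
    · rw [mul_assoc, ← mul_sub, abs_mul, abs_of_nonneg (h.v0 τ b), mul_comm (unif M r)]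
    · simp
  refine (Finset.sum_le_sum fun w _ => e3 w).trans (le_of_eq ?_)
  rw [Finset.sum_comm]
  refine Finset.sum_congr rfl fun τ _ => ?_
  simp only [Fintype.sum_prod_type, devm]
  rw [Finset.sum_mul]
  refine Finset.sum_congr rfl fun b _ => ?_
  rw [Finset.mul_sum, Finset.sum_comm]
  refine Finset.sum_congr rfl fun r _ => ?_
  simp

/-- The `i`-th pair `(Q_i, S_{i,1})`, with `none` the main one. -/
def yv {α : Type} {m : ℕ} (z : α × (Fin m → α)) : Option (Fin m) → α
  | none => z.1
  | some i => z.2 i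

theorem la_induct {ℓ t m n nq : ℕ} (k kq ε K : ℝ) (hε : 0 ≤ ε)
    (Extq : BitStr nq → BitStr ℓ → BitStr ℓ) (Extw : BitStr n → BitStr ℓ → BitStr ℓ)
    (hq : IsStrongSeededExtractor Extq K ε) (hw : IsStrongSeededExtractor Extw K ε)
    (pX : BitStr n → ℝ)
    (pY : (BitStr nq × BitStr ℓ) × (Fin m → BitStr nq × BitStr ℓ) → ℝ)
    (hX : IsProb pX) (hY : IsProb pY)
    (hk : ∀ q, fibm (fun x => x) pX q ≤ (2:ℝ) ^ (-k))
    (hkq : ∀ q, fibm (fun z => z.1.1) pY q ≤ (2:ℝ) ^ (-kq))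
    (hs : ∀ s, fibm (fun z => z.1.2) pY s = unif (BitStr ℓ) s)
    (hN : ∀ j ≤ t, (2:ℝ) ^ (K - k) * (Fintype.card (Option (Fin m) → BitStr ℓ) : ℝ) ^ j ≤ ε)
    (hNq : ∀ j ≤ t, (2:ℝ) ^ (K - kq) * (Fintype.card (Option (Fin m) → BitStr ℓ) : ℝ) ^ j ≤ ε)
    (j : ℕ) (hj : j < t) :
    ∃ (T : Type) (_ : Fintype T) (_ : DecidableEq T) (u : T → BitStr n → ℝ)
      (v : T → ((BitStr nq × BitStr ℓ) × (Fin m → BitStr nq × BitStr ℓ)) → ℝ)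
      (tr : BitStr n → ((BitStr nq × BitStr ℓ) × (Fin m → BitStr nq × BitStr ℓ)) → T)
      (g : T → ((BitStr nq × BitStr ℓ) × (Fin m → BitStr nq × BitStr ℓ)) →
        Option (Fin m) → BitStr ℓ)
      (hist : T → Fin m → ℕ → BitStr ℓ),
      PState pX pY u v tr ((Fintype.card (Option (Fin m) → BitStr ℓ) : ℝ) ^ j)
        ((Fintype.card (Option (Fin m) → BitStr ℓ) : ℝ) ^ j) ∧
      (∀ x z i, g (tr x z) z i = laS Extq Extw x (yv z i).1 (yv z i).2 j) ∧
      (∀ x z i jj, jj < j → hist (tr x z) i jj = laR Extq Extw x (z.2 i).1 (z.2 i).2 jj) ∧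
      ∑ τ, (∑ a, u τ a) * devm (fun b => g τ b none) (v τ) ≤ 8 * j * ε := by
  induction j with
  | zero =>
    refine ⟨Unit, inferInstance, inferInstance, fun _ => pX, fun _ => pY, fun _ _ => (),
      fun _ z i => (yv z i).2, fun _ _ _ _ => false, ?_, ?_, ?_, ?_⟩
    · refine ⟨fun _ => hX.1, fun _ => hY.1, fun _ _ => le_rfl, fun _ _ => le_rfl, ?_, ?_, ?_⟩
      · simp
      · simp [hX.2]
      · simp [hY.2]
    · intro x z i; rfl
    · intro x z i jj h; omega
    · have : devm (fun b : (BitStr nq × BitStr ℓ) × (Fin m → BitStr nq × BitStr ℓ) =>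
          (yv b none).2) pY = 0 := by
        refine Finset.sum_eq_zero fun r _ => ?_
        rw [hY.2]
        have := hs r
        simp only [yv]
        rw [this]; simp
      simp [this]
  | succ j ih =>
    obtain ⟨T, iT, dT, u, v, tr, g, hist, hP, hg, hh, he⟩ := ih (by omega)
    have s1 := hP.step hX.2 hY.2 g none Extw K ε k hε hw (fun x => x) hk (hN j (by omega))
    have P1 := hP.extend g
    rw [← pow_succ] at P1
    have s2 := P1.swap.step hY.2 hX.2 (fun τ x i => Extw x (τ.2 i)) none Extq K ε kq hε hq
      (fun z => z.1.1) hkq (hNq (j+1) (by omega))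
    have P2 := P1.swap.extend (fun τ x i => Extw x (τ.2 i))
    rw [← pow_succ] at P2
    refine ⟨_, inferInstance, inferInstance, _, _, _,
      fun τ z i => Extq (yv z i).1 (τ.2 i),
      fun τ i jj => if jj < j then hist τ.1.1 i jj else τ.2 (some i), P2.swap, ?_, ?_, ?_⟩
    · intro x z i
      simp only [hg]
      rfl
    · intro x z i jj hjj
      dsimp only
      split_ifs with hc
      · exact hh x z i jj hc
      · have : jj = j := by omega
        subst this
        rw [hg]; rfl
    · refine s2.trans ?_
      refine (add_le_add_left (s1.trans (add_le_add_left he _)) _).trans ?_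
      push_cast
      linarith

theorem la_numeric (a m t ℓ j : ℕ) (k ε : ℝ) (hε : 0 < ε) (hε1 : ε ≤ 1)
    (h : (((m + 1) * t * ℓ + a : ℕ) : ℝ) + 2 * Real.logb 2 (1 / ε) < k) (hj : j ≤ t) :
    (2:ℝ) ^ ((a : ℝ) - k) * (Fintype.card (Option (Fin m) → BitStr ℓ) : ℝ) ^ j ≤ ε := by
  have hc : (Fintype.card (Option (Fin m) → BitStr ℓ) : ℝ) ^ j
      = (2:ℝ) ^ (((m + 1) * j * ℓ : ℕ) : ℝ) := by
    rw [Real.rpow_natCast]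
    simp only [Fintype.card_pi, Fintype.card_bool, Finset.prod_const, Finset.card_univ,
      Fintype.card_fin, Fintype.card_option]
    push_cast
    rw [← pow_mul, ← pow_mul]
    congr 1; ring
  rw [hc, ← Real.rpow_add (by norm_num)]
  have hl : ε = (2:ℝ) ^ (Real.logb 2 ε) := (Real.rpow_logb (by norm_num) (by norm_num) hε).symm
  have hl0 : Real.logb 2 ε ≤ 0 := Real.logb_nonpos (by norm_num) hε.le hε1
  rw [one_div, Real.logb_inv] at h
  conv_rhs => rw [hl]
  refine Real.rpow_le_rpow_of_exponent_le (by norm_num) ?_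
  have : (((m + 1) * j * ℓ : ℕ) : ℝ) ≤ (((m + 1) * t * ℓ : ℕ) : ℝ) := by
    exact_mod_cast Nat.mul_le_mul_right _ (Nat.mul_le_mul_left _ hj)
  rw [Nat.cast_add] at h
  linarith

theorem la_main {ℓ t m n nq : ℕ} (k kq ε K : ℝ) (hε : 0 ≤ ε)
    (Extq : BitStr nq → BitStr ℓ → BitStr ℓ) (Extw : BitStr n → BitStr ℓ → BitStr ℓ)
    (hq : IsStrongSeededExtractor Extq K ε) (hw : IsStrongSeededExtractor Extw K ε)
    (pX : BitStr n → ℝ)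
    (pY : (BitStr nq × BitStr ℓ) × (Fin m → BitStr nq × BitStr ℓ) → ℝ)
    (hX : IsProb pX) (hY : IsProb pY)
    (hk : ∀ q, fibm (fun x => x) pX q ≤ (2:ℝ) ^ (-k))
    (hkq : ∀ q, fibm (fun z => z.1.1) pY q ≤ (2:ℝ) ^ (-kq))
    (hs : ∀ s, fibm (fun z => z.1.2) pY s = unif (BitStr ℓ) s)
    (hN : ∀ j ≤ t, (2:ℝ) ^ (K - k) * (Fintype.card (Option (Fin m) → BitStr ℓ) : ℝ) ^ j ≤ ε)
    (hNq : ∀ j ≤ t, (2:ℝ) ^ (K - kq) * (Fintype.card (Option (Fin m) → BitStr ℓ) : ℝ) ^ j ≤ ε)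
    (j : ℕ) (hj : j < t) :
    ∑ w : ((BitStr nq × BitStr ℓ) × (Fin m → BitStr nq × BitStr ℓ))
        × (Fin m → Fin j → BitStr ℓ) × BitStr ℓ,
      |(∑ x : BitStr n,
          if (∀ i : Fin m, ∀ jj : Fin j,
                laR Extq Extw x (w.1.2 i).1 (w.1.2 i).2 (jj : ℕ) = w.2.1 i jj) ∧
              laR Extq Extw x w.1.1.1 w.1.1.2 j = w.2.2
          then pX x * pY w.1 else 0) -
        (∑ x : BitStr n,
          if ∀ i : Fin m, ∀ jj : Fin j,
                laR Extq Extw x (w.1.2 i).1 (w.1.2 i).2 (jj : ℕ) = w.2.1 i jj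
          then pX x * pY w.1 else 0) * unif (BitStr ℓ) w.2.2| ≤ 8 * t * ε := by
  obtain ⟨T, iT, dT, u, v, tr, g, hist, hP, hg, hh, he⟩ :=
    la_induct k kq ε K hε Extq Extw hq hw pX pY hX hY hk hkq hs hN hNq j hj
  have s1 := hP.step hX.2 hY.2 g none Extw K ε k hε hw (fun x => x) hk (hN j (by omega))
  have P1 := hP.extend g
  have F := P1.final (fun τ x => Extw x (τ.2 none))
    (fun τ => (fun (i : Fin m) (jj : Fin j) => hist τ.1 i jj))
  have hb : 8 * (j:ℝ) * ε + 4 * ε ≤ 8 * t * ε := by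
    have : ((j:ℝ) + 1) ≤ t := by exact_mod_cast hj
    nlinarith
  refine le_trans (le_of_eq ?_) ((F.trans s1).trans ((add_le_add_left he _).trans hb))
  refine Finset.sum_congr rfl fun w _ => ?_
  have c1 : ∀ x, (∀ i : Fin m, ∀ jj : Fin j,
      laR Extq Extw x (w.1.2 i).1 (w.1.2 i).2 (jj : ℕ) = w.2.1 i jj) ↔
      (fun (i : Fin m) (jj : Fin j) => hist (tr x w.1) i jj) = w.2.1 := by
    intro x
    simp only [funext_iff]
    exact forall_congr' fun i => forall_congr' fun jj => by rw [hh x w.1 i jj jj.2]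
  have c2 : ∀ x, laR Extq Extw x w.1.1.1 w.1.1.2 j = Extw x (g (tr x w.1) w.1 none) := by
    intro x
    rw [hg]; rfl
  simp only [c1, c2]

theorem la_trivial {A B H M : Type} [Fintype A] [Fintype B]
    [Fintype H] [DecidableEq H] [Fintype M] [Nonempty M] [DecidableEq M]
    (pX : A → ℝ) (pY : B → ℝ) (hX : IsProb pX) (hY : IsProb pY)
    (f : A → B → M) (hist : A → B → H) :
    ∑ w : B × H × M, |(∑ a, if hist a w.1 = w.2.1 ∧ f a w.1 = w.2.2
          then pX a * pY w.1 else 0)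
        - (∑ a, if hist a w.1 = w.2.1 then pX a * pY w.1 else 0) * unif M w.2.2| ≤ 2 := by
  classical
  have P : PState (T := A × B) pX pY
      (fun τ x => if x = τ.1 then pX x else 0) (fun τ z => if z = τ.2 then pY z else 0)
      (fun x z => (x, z)) _ _ :=
    { u0 := fun τ a => by
        split_ifs
        · exact hX.1 a
        · exact le_rfl
      v0 := fun τ b => by
        split_ifs
        · exact hY.1 b
        · exact le_rfl
      uA := fun τ a => by
        split_ifs
        · exact le_rfl
        · exact hX.1 a
      vB := fun τ b => by
        split_ifs
        · exact le_rfl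
        · exact hY.1 b
      joint := by
        rintro ⟨x, z⟩ a b
        simp only [Prod.mk.injEq, mul_ite, ite_mul, zero_mul, mul_zero, ite_and]
        split_ifs <;> rfl
      nA := le_rfl
      nB := le_rfl }
  have F := P.final (fun τ x => f x τ.2) (fun τ => hist τ.1 τ.2)
  have G : ∀ τ : A × B, _ := fun τ => mul_le_mul_of_nonneg_left
    (devm_le (fun x => f x τ.2) _ (P.u0 τ))
    (Finset.sum_nonneg (s := Finset.univ) fun b _ => P.v0 τ b)
  have F2 := F.trans (Finset.sum_le_sum fun τ _ => G τ)
  have tot := P.total hX.2 hY.2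
  have e : ∀ a b : ℝ, a * (2 * b) = 2 * (b * a) := fun a b => by ring
  simp only [e] at F2
  rw [← Finset.mul_sum, tot] at F2
  linarith

end Helpers

/-- Lemma on alternating extraction, \cite{Li13b}.
`Y = (Q, S₁)` with `Q` an `(n_q, k_q)`-source and `S₁` uniform on `{0,1}^ℓ`;
`Y₂, …, Y_h` (here indexed by `Fin (h−1)`) arbitrarily correlated with `Y`; `X` an
`(n,k)`-source independent of `(Y, Y₂, …, Y_h)`; `Ext_q, Ext_w` strong `(10ℓ, ε)`
extractors; `k, k_q > htℓ + 10ℓ + 2log₂(1/ε)`. Then for every `0 ≤ j ≤ t−1`,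
`(Y, Y₂,…,Y_h, {R_{i,1..j}}, R_{j+1})` is `O(tε)`-close to
`(Y, Y₂,…,Y_h, {R_{i,1..j}}, U_ℓ)`. -/
theorem alternating_extraction_lookahead :
    ∃ c : ℝ, 0 < c ∧
      ∀ (ℓ t h n nq : ℕ) (k kq ε : ℝ), 2 ≤ h → 0 < ε →
        ∀ (Extq : BitStr nq → BitStr ℓ → BitStr ℓ)
          (Extw : BitStr n → BitStr ℓ → BitStr ℓ),
          IsStrongSeededExtractor Extq (10 * ℓ : ℕ) ε →
          IsStrongSeededExtractor Extw (10 * ℓ : ℕ) ε →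
          ∀ (pX : BitStr n → ℝ)
            (pY : (BitStr nq × BitStr ℓ) × (Fin (h - 1) → BitStr nq × BitStr ℓ) → ℝ),
            IsProb pX → IsProb pY → IsKSource pX k →
            IsKSource (fun q : BitStr nq => ∑ ys, if ys.1.1 = q then pY ys else 0) kq →
            (∀ s : BitStr ℓ, (∑ ys, if ys.1.2 = s then pY ys else 0) = unif (BitStr ℓ) s) →
            ((h * t * ℓ + 10 * ℓ : ℕ) : ℝ) + 2 * Real.logb 2 (1 / ε) < k →
            ((h * t * ℓ + 10 * ℓ : ℕ) : ℝ) + 2 * Real.logb 2 (1 / ε) < kq →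
            ∀ j : ℕ, j < t →
              statDist
                (fun w : ((BitStr nq × BitStr ℓ) × (Fin (h - 1) → BitStr nq × BitStr ℓ))
                    × (Fin (h - 1) → Fin j → BitStr ℓ) × BitStr ℓ =>
                  ∑ x : BitStr n,
                    if (∀ i : Fin (h - 1), ∀ jj : Fin j,
                          laR Extq Extw x (w.1.2 i).1 (w.1.2 i).2 (jj : ℕ) = w.2.1 i jj) ∧
                        laR Extq Extw x w.1.1.1 w.1.1.2 j = w.2.2
                    then pX x * pY w.1 else 0)
                (fun w =>
                  (∑ x : BitStr n,
                    if ∀ i : Fin (h - 1), ∀ jj : Fin j,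
                          laR Extq Extw x (w.1.2 i).1 (w.1.2 i).2 (jj : ℕ) = w.2.1 i jj
                    then pX x * pY w.1 else 0) * unif (BitStr ℓ) w.2.2)
              ≤ c * t * ε := by
  refine ⟨8, by norm_num, ?_⟩
  intro ℓ t h n nq k kq ε hh hε Extq Extw hq hw pX pY hX hY hk hkq hs hkb hkqb j hj
  obtain ⟨m, rfl⟩ : ∃ m, h = m + 1 := ⟨h - 1, by omega⟩
  refine (statDist_le_l1 _ _).trans ?_
  by_cases hε1 : ε ≤ 1
  · refine la_main k kq ε _ hε.le Extq Extw hq hw pX pY hX hY ?_ hkq hs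
      (fun j' hj' => la_numeric _ m t ℓ j' k ε hε hε1 hkb hj')
      (fun j' hj' => la_numeric _ m t ℓ j' kq ε hε hε1 hkqb hj') j hj
    intro q
    simpa [fibm] using hk q
  · push Not at hε1
    have F2 := la_trivial pX pY hX hY (fun x z => laR Extq Extw x z.1.1 z.1.2 j)
      (fun x z => (fun (i : Fin (m + 1 - 1)) (jj : Fin j) =>
        laR Extq Extw x (z.2 i).1 (z.2 i).2 (jj : ℕ)))
    simp only [funext_iff] at F2
    simp only [funext_iff]
    refine F2.trans ?_
    have : (1:ℝ) ≤ t := by exact_mod_cast (by omega : 1 ≤ t)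
    nlinarith
end
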